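/- With $m$ as in the localized minimum problem, for every $x\in\Omega$, $\rho\in(0,\mathrm{dist}(x,\partial\Omega))$ and unit vectors $\nu_1,\nu_2$, one has $|m(x,\nu_1,\rho)-m(x,\nu_2,\rho)|\le C\int_{\partial B_\rho(x)}|\mathrm{tr}(u_{x,\nu_1}-u_{x,\nu_2})|\,d\mathcal{H}^{d-1}\le C'\rho^{d-1}\arccos(\langle\nu_1,\nu_2\rangle)$; in particular $\nu\mapsto m(x,\nu,\rho)$ admits a modulus of continuity of the form $\rho^{d-1}\omega(|\nu_1-\nu_2|)$. -/

import Mathlib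

open MeasureTheory Metric Filter
open scoped RealInnerProductSpace

variable {d : ℕ}

/-- `(σ, f)` is the interface representation of a spin field `u ∈ BV(Ω; {±1})`:
`u = ±1` a.e. in `Ω`, `σ = H^{d-1} ⌞ ∂*{u=1}` is locally finite in `Ω` and carried
by `Ω`, `f = ν_u` is the (unit) inner normal `σ`-a.e., and `Du = 2 f σ` in the sense
of distributions on `Ω`. -/
def IsSpinRep (Ω : Set (EuclideanSpace ℝ (Fin d))) (u : EuclideanSpace ℝ (Fin d) → ℝ)
    (σ : Measure (EuclideanSpace ℝ (Fin d)))
    (f : EuclideanSpace ℝ (Fin d) → EuclideanSpace ℝ (Fin d)) : Prop :=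
  (∀ᵐ x ∂volume, x ∈ Ω → u x = 1 ∨ u x = -1) ∧
  (∀ x ∈ Ω, ∃ s ∈ nhds x, σ s < ⊤) ∧ σ Ωᶜ = 0 ∧
  (∀ᵐ x ∂σ, ‖f x‖ = 1) ∧
  (∀ ψ : EuclideanSpace ℝ (Fin d) → ℝ, ContDiff ℝ (⊤ : ℕ∞) ψ → HasCompactSupport ψ →
    tsupport ψ ⊆ Ω → ∀ v : EuclideanSpace ℝ (Fin d),
      ∫ x, u x * fderiv ℝ ψ x v = -2 * ∫ x, ψ x * ⟪f x, v⟫ ∂σ)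

/-- The localized surface energy `E(u,A) = ∫_{∂*{u=1}∩A} g(x,ν_u) dH^{d-1}`, computed
through the interface representation `(σ, f)`. -/
noncomputable def surfE (g : EuclideanSpace ℝ (Fin d) → EuclideanSpace ℝ (Fin d) → ℝ)
    (σ : Measure (EuclideanSpace ℝ (Fin d)))
    (f : EuclideanSpace ℝ (Fin d) → EuclideanSpace ℝ (Fin d))
    (A : Set (EuclideanSpace ℝ (Fin d))) : ℝ :=
  ∫ x in A, g x (f x) ∂σ

/-- The half-space spin configuration `u_{x,ν}`. -/
noncomputable def ujump (x ν : EuclideanSpace ℝ (Fin d)) (y : EuclideanSpace ℝ (Fin d)) : ℝ :=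
  if 0 < ⟪y - x, ν⟫ then 1 else -1

/-- The localized minimum problem `m(x,ν,ρ)`: the least surface energy in `B_ρ(x)` of a
spin field equal to `u_{x,ν}` in a neighborhood of `∂B_ρ(x)`. -/
noncomputable def mloc (Ω : Set (EuclideanSpace ℝ (Fin d)))
    (g : EuclideanSpace ℝ (Fin d) → EuclideanSpace ℝ (Fin d) → ℝ)
    (x ν : EuclideanSpace ℝ (Fin d)) (ρ : ℝ) : ℝ :=
  sInf {e : ℝ | ∃ (v : EuclideanSpace ℝ (Fin d) → ℝ)
      (σ : Measure (EuclideanSpace ℝ (Fin d)))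
      (f : EuclideanSpace ℝ (Fin d) → EuclideanSpace ℝ (Fin d)),
    IsSpinRep Ω v σ f ∧
    (∃ δ : ℝ, 0 < δ ∧ ∀ᵐ y ∂volume, y ∈ Ω → |dist y x - ρ| < δ → v y = ujump x ν y) ∧
    e = surfE g σ f (ball x ρ)}

/-- Coordinates along `b 0` and along the remaining vectors of an orthonormal basis. -/
noncomputable def adaptedMap {n : ℕ}
    (b : OrthonormalBasis (Fin (n + 1)) ℝ (EuclideanSpace ℝ (Fin (n + 1))))
    (p : ℝ × (Fin n → ℝ)) : EuclideanSpace ℝ (Fin (n + 1)) :=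
  b.repr.symm (WithLp.toLp 2 (Fin.cons p.1 p.2 : Fin (n + 1) → ℝ))

section Coordinates

variable {n : ℕ} (b : OrthonormalBasis (Fin (n + 1)) ℝ (EuclideanSpace ℝ (Fin (n + 1))))

theorem exists_orthonormalBasis_apply_zero {ν : EuclideanSpace ℝ (Fin (n + 1))} (hν : ‖ν‖ = 1) :
    ∃ b : OrthonormalBasis (Fin (n + 1)) ℝ (EuclideanSpace ℝ (Fin (n + 1))), b 0 = ν := by
  obtain ⟨b, hb⟩ := Orthonormal.exists_orthonormalBasis_extension_of_card_eq (𝕜 := ℝ)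
    (E := EuclideanSpace ℝ (Fin (n + 1))) (ι := Fin (n + 1)) (by simp) (v := fun _ => ν)
    (s := {0}) (by
      rw [orthonormal_iff_ite]
      rintro ⟨i, hi⟩ ⟨j, hj⟩
      simp only [Set.mem_singleton_iff] at hi hj
      subst hi; subst hj
      simp [Set.domRestrict, hν])
  exact ⟨b, hb 0 (by simp)⟩

theorem inner_adaptedMap (p : ℝ × (Fin n → ℝ)) (i : Fin (n + 1)) :
    ⟪b i, adaptedMap b p⟫ = (Fin.cons p.1 p.2 : Fin (n + 1) → ℝ) i := by
  rw [← b.repr_apply_apply, adaptedMap, LinearIsometryEquiv.apply_symm_apply]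

theorem inner_zero_adaptedMap (p : ℝ × (Fin n → ℝ)) : ⟪b 0, adaptedMap b p⟫ = p.1 := by
  simp [inner_adaptedMap]

theorem adaptedMap_inner (y : EuclideanSpace ℝ (Fin (n + 1))) :
    adaptedMap b (⟪b 0, y⟫, fun i => ⟪b i.succ, y⟫) = y := by
  refine InnerProductSpace.ext_inner_left_basis b.toBasis fun i => ?_
  rw [b.coe_toBasis, inner_adaptedMap]
  refine Fin.cases ?_ (fun j => ?_) i <;> simp

theorem adaptedMap_eq_add (t : ℝ) (z : Fin n → ℝ) :
    adaptedMap b (t, z) = t • b 0 + adaptedMap b (0, z) := by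
  refine InnerProductSpace.ext_inner_left_basis b.toBasis fun i => ?_
  rw [b.coe_toBasis, inner_adaptedMap, inner_add_right, inner_adaptedMap, inner_smul_right]
  refine Fin.cases ?_ (fun j => ?_) i
  · simp
  · have : ⟪b j.succ, b 0⟫ = 0 := b.orthonormal.2 (Fin.succ_ne_zero j)
    simp [this]

theorem continuous_adaptedMap : Continuous (adaptedMap b) := by
  unfold adaptedMap
  refine b.repr.symm.continuous.comp ((PiLp.continuous_toLp 2 _).comp ?_)
  refine continuous_pi fun i => ?_
  refine Fin.cases ?_ (fun j => ?_) i <;> simp <;> fun_prop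

theorem adaptedMap_eq_comp :
    adaptedMap b = b.repr.symm ∘ (WithLp.toLp 2 : (Fin (n + 1) → ℝ) → _) ∘
      (MeasurableEquiv.piFinSuccAbove (fun _ : Fin (n + 1) => ℝ) 0).symm := by
  funext p
  simp [adaptedMap]
  rfl

theorem measurePreserving_adaptedMap : MeasurePreserving (adaptedMap b) := by
  rw [adaptedMap_eq_comp]
  exact b.measurePreserving_repr_symm.comp ((PiLp.volume_preserving_toLp (Fin (n + 1))).comp
    (volume_preserving_piFinSuccAbove (fun _ : Fin (n + 1) => ℝ) 0).symm)

theorem measurableEmbedding_adaptedMap : MeasurableEmbedding (adaptedMap b) := by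
  rw [adaptedMap_eq_comp]
  exact b.repr.symm.toHomeomorph.measurableEmbedding.comp
    ((MeasurableEquiv.toLp 2 (Fin (n + 1) → ℝ)).measurableEmbedding.comp
      (MeasurableEquiv.piFinSuccAbove (fun _ : Fin (n + 1) => ℝ) 0).symm.measurableEmbedding)

theorem abs_le_norm_adaptedMap (t : ℝ) (z : Fin n → ℝ) (i : Fin n) :
    |z i| ≤ ‖adaptedMap b (t, z)‖ := by
  have h := abs_real_inner_le_norm (b i.succ) (adaptedMap b (t, z))
  rwa [inner_adaptedMap, b.norm_eq_one, one_mul, Fin.cons_succ] at h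

end Coordinates

section HalfSpace

variable {n : ℕ}

theorem measurable_ujump (x ν : EuclideanSpace ℝ (Fin d)) : Measurable (ujump x ν) := by
  unfold ujump
  refine Measurable.ite ?_ measurable_const measurable_const
  exact measurableSet_lt measurable_const (by fun_prop)

theorem ujump_eq_or (x ν y : EuclideanSpace ℝ (Fin d)) : ujump x ν y = 1 ∨ ujump x ν y = -1 := by
  unfold ujump
  split_ifs <;> simp

theorem abs_ujump (x ν y : EuclideanSpace ℝ (Fin d)) : |ujump x ν y| = 1 := by
  rcases ujump_eq_or x ν y with h | h <;> simp [h]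

theorem integrable_ujump_mul (x ν : EuclideanSpace ℝ (Fin d)) {φ : EuclideanSpace ℝ (Fin d) → ℝ}
    (hφ : Integrable φ) : Integrable fun y => ujump x ν y * φ y :=
  hφ.bdd_mul (c := 1) (measurable_ujump x ν).aestronglyMeasurable
    (Eventually.of_forall fun y => by rw [Real.norm_eq_abs, abs_ujump])

theorem continuous_fderiv_apply_const {ψ : EuclideanSpace ℝ (Fin d) → ℝ} (hψ : ContDiff ℝ 1 ψ)
    (e : EuclideanSpace ℝ (Fin d)) : Continuous fun y => fderiv ℝ ψ y e :=
  (hψ.continuous_fderiv one_ne_zero).clm_apply continuous_const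

theorem integrable_fderiv_apply_const {ψ : EuclideanSpace ℝ (Fin d) → ℝ} (hψ : ContDiff ℝ 1 ψ)
    (hc : HasCompactSupport ψ) (e : EuclideanSpace ℝ (Fin d)) :
    Integrable fun y => fderiv ℝ ψ y e :=
  (continuous_fderiv_apply_const hψ e).integrable_of_hasCompactSupport (hc.fderiv_apply ℝ e)

theorem integral_ujump_mul_fderiv_of_inner_eq_zero (x ν : EuclideanSpace ℝ (Fin d))
    {ψ : EuclideanSpace ℝ (Fin d) → ℝ} (hψ : ContDiff ℝ 1 ψ) (hc : HasCompactSupport ψ)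
    {e : EuclideanSpace ℝ (Fin d)} (he : ⟪e, ν⟫ = 0) :
    ∫ y, ujump x ν y * fderiv ℝ ψ y e = 0 := by
  have h := integral_bilinear_hasLineDerivAt_right_eq_neg_left_of_integrable (μ := volume)
    (f := ujump x ν) (f' := fun _ => 0) (g := ψ) (g' := fun y => fderiv ℝ ψ y e) (v := e)
    (B := ContinuousLinearMap.mul ℝ ℝ) (by simp)
    (by simpa using integrable_ujump_mul x ν (integrable_fderiv_apply_const hψ hc e))
    (by simpa using integrable_ujump_mul x ν (hψ.continuous.integrable_of_hasCompactSupport hc))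
    (fun y _ => by
      have : (fun t : ℝ => ujump x ν (y + t • e)) = fun _ => ujump x ν y := by
        funext t
        have : ⟪y + t • e - x, ν⟫ = ⟪y - x, ν⟫ := by
          rw [add_sub_right_comm, inner_add_left, real_inner_smul_left, he]; simp
        simp [ujump, this]
      unfold HasLineDerivAt
      rw [this]
      exact hasDerivAt_const _ _)
    (fun y _ => (hψ.differentiable one_ne_zero y).hasFDerivAt.hasLineDerivAt e)
  simpa using h

variable (b : OrthonormalBasis (Fin (n + 1)) ℝ (EuclideanSpace ℝ (Fin (n + 1))))

theorem integral_sign_mul_deriv {φ : ℝ → ℝ} (hφ : ContDiff ℝ 1 φ) (hc : HasCompactSupport φ) :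
    ∫ t, (if 0 < t then (1 : ℝ) else -1) * deriv φ t = -2 * φ 0 := by
  have hint : Integrable (deriv φ) :=
    (hφ.continuous_deriv le_rfl).integrable_of_hasCompactSupport hc.deriv
  have hint' : Integrable fun t => (if 0 < t then (1 : ℝ) else -1) * deriv φ t := by
    refine hint.bdd_mul (c := 1) ?_ (Eventually.of_forall fun t => by split_ifs <;> simp)
    exact (Measurable.ite measurableSet_Ioi measurable_const
      measurable_const).aestronglyMeasurable
  rw [← integral_add_compl measurableSet_Ioi hint' (s := Set.Ioi 0), Set.compl_Ioi,
    setIntegral_congr_fun (g := deriv φ) measurableSet_Ioi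
      (fun t ht => by simp [Set.mem_Ioi.1 ht]),
    setIntegral_congr_fun (s := Set.Iic 0) (g := fun t => - deriv φ t) measurableSet_Iic
      (fun t ht => by simp [not_lt.2 (Set.mem_Iic.1 ht)]),
    hc.integral_Ioi_deriv_eq hφ, integral_neg, hc.integral_Iic_deriv_eq hφ]
  ring

theorem HasCompactSupport.comp_adaptedMap {ψ : EuclideanSpace ℝ (Fin (n + 1)) → ℝ}
    (hc : HasCompactSupport ψ) (x : EuclideanSpace ℝ (Fin (n + 1))) :
    HasCompactSupport fun z : Fin n → ℝ => ψ (x + adaptedMap b (0, z)) := by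
  obtain ⟨R, hR⟩ := hc.isCompact.isBounded.subset_closedBall x
  refine HasCompactSupport.of_support_subset_isCompact
    (isCompact_closedBall (0 : Fin n → ℝ) (max R 0)) fun z hz => ?_
  have h := mem_closedBall.1 (hR (subset_tsupport _ hz))
  rw [dist_self_add_left] at h
  rw [mem_closedBall_zero_iff, pi_norm_le_iff_of_nonneg (le_max_right _ _)]
  exact fun i => (abs_le_norm_adaptedMap b 0 z i).trans (h.trans (le_max_left _ _))

theorem integral_ujump_mul_fderiv_normal (x : EuclideanSpace ℝ (Fin (n + 1)))
    {ψ : EuclideanSpace ℝ (Fin (n + 1)) → ℝ} (hψ : ContDiff ℝ 1 ψ) (hc : HasCompactSupport ψ) :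
    ∫ y, ujump x (b 0) y * fderiv ℝ ψ y (b 0) = -2 * ∫ z, ψ (x + adaptedMap b (0, z)) := by
  have hint : Integrable fun p : ℝ × (Fin n → ℝ) =>
      ujump x (b 0) (x + adaptedMap b p) * fderiv ℝ ψ (x + adaptedMap b p) (b 0) :=
    (measurePreserving_adaptedMap b).integrable_comp_emb (measurableEmbedding_adaptedMap b)
      |>.2 ((integrable_ujump_mul x (b 0)
        (integrable_fderiv_apply_const hψ hc (b 0))).comp_add_left x)
  rw [← integral_add_left_eq_self _ x,
    ← (measurePreserving_adaptedMap b).integral_comp (measurableEmbedding_adaptedMap b),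
    Measure.volume_eq_prod, integral_prod_symm _ hint, ← integral_const_mul]
  congr 1
  funext z
  have hder : ∀ t : ℝ, HasDerivAt (fun t : ℝ => ψ (x + adaptedMap b (t, z)))
      (fderiv ℝ ψ (x + adaptedMap b (t, z)) (b 0)) t := by
    intro t
    have h1 : HasDerivAt (fun t : ℝ => x + adaptedMap b (t, z)) (b 0) t := by
      rw [funext fun t => congrArg (x + ·) (adaptedMap_eq_add b t z)]
      simpa using (((hasDerivAt_id t).smul_const (b 0)).add_const (adaptedMap b (0, z))).const_add x
    exact (hψ.differentiable one_ne_zero _).hasFDerivAt.comp_hasDerivAt t h1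
  have hcd : ContDiff ℝ 1 fun t : ℝ => ψ (x + adaptedMap b (t, z)) := by
    rw [funext fun t => congrArg (fun y => ψ (x + y)) (adaptedMap_eq_add b t z)]
    fun_prop
  have hcs : HasCompactSupport fun t : ℝ => ψ (x + adaptedMap b (t, z)) := by
    obtain ⟨R, hR⟩ := hc.isCompact.isBounded.subset_closedBall x
    refine HasCompactSupport.of_support_subset_isCompact
      (isCompact_closedBall (0 : ℝ) R) fun t ht => ?_
    have h := mem_closedBall.1 (hR (subset_tsupport _ ht))
    rw [dist_self_add_left] at h
    have h' := abs_real_inner_le_norm (b 0) (adaptedMap b (t, z))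
    rw [inner_zero_adaptedMap, b.norm_eq_one, one_mul] at h'
    simpa using h'.trans h
  rw [← integral_sign_mul_deriv hcd hcs]
  congr 1
  funext t
  rw [(hder t).deriv]
  simp [ujump, real_inner_comm (b 0), inner_zero_adaptedMap]

theorem integral_ujump_mul_fderiv (x : EuclideanSpace ℝ (Fin (n + 1)))
    {ψ : EuclideanSpace ℝ (Fin (n + 1)) → ℝ} (hψ : ContDiff ℝ 1 ψ) (hc : HasCompactSupport ψ)
    (e : EuclideanSpace ℝ (Fin (n + 1))) :
    ∫ y, ujump x (b 0) y * fderiv ℝ ψ y e =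
      -2 * ∫ z, ψ (x + adaptedMap b (0, z)) * ⟪b 0, e⟫ := by
  have hdec : e = (e - ⟪b 0, e⟫ • b 0) + ⟪b 0, e⟫ • b 0 := by simp
  have horth : ⟪e - ⟪b 0, e⟫ • b 0, b 0⟫ = 0 := by
    rw [inner_sub_left, real_inner_smul_left, real_inner_comm, real_inner_self_eq_norm_sq,
      b.norm_eq_one]
    ring
  have hfun : (fun y => ujump x (b 0) y * fderiv ℝ ψ y e) = fun y =>
      ujump x (b 0) y * fderiv ℝ ψ y (e - ⟪b 0, e⟫ • b 0) +
        ⟪b 0, e⟫ * (ujump x (b 0) y * fderiv ℝ ψ y (b 0)) := by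
    funext y
    conv_lhs => rw [hdec]
    rw [map_add, map_smul, smul_eq_mul]
    ring
  rw [hfun, integral_add (integrable_ujump_mul x _ (integrable_fderiv_apply_const hψ hc _))
    ((integrable_ujump_mul x _ (integrable_fderiv_apply_const hψ hc _)).const_mul _),
    integral_ujump_mul_fderiv_of_inner_eq_zero x _ hψ hc horth, integral_const_mul,
    integral_ujump_mul_fderiv_normal b x hψ hc, integral_mul_const]
  ring

/-- The Lebesgue measure of the hyperplane through `x` orthogonal to `b 0`. -/
noncomputable def hyperplaneMeasure (x : EuclideanSpace ℝ (Fin (n + 1))) :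
    Measure (EuclideanSpace ℝ (Fin (n + 1))) :=
  Measure.map (fun z : Fin n → ℝ => x + adaptedMap b (0, z)) volume

theorem continuous_hyperplane (x : EuclideanSpace ℝ (Fin (n + 1))) :
    Continuous fun z : Fin n → ℝ => x + adaptedMap b (0, z) := by
  have := continuous_adaptedMap b
  fun_prop

theorem hyperplaneMeasure_closedBall_lt_top (x : EuclideanSpace ℝ (Fin (n + 1))) (R : ℝ) :
    hyperplaneMeasure b x (closedBall x R) < ⊤ := by
  rw [hyperplaneMeasure, Measure.map_apply (continuous_hyperplane b x).measurable
    isClosed_closedBall.measurableSet]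
  refine (measure_mono fun z hz => ?_).trans_lt
    (isCompact_closedBall (0 : Fin n → ℝ) (max R 0)).measure_lt_top
  have h := mem_closedBall.1 (Set.mem_preimage.1 hz)
  rw [dist_self_add_left] at h
  rw [mem_closedBall_zero_iff, pi_norm_le_iff_of_nonneg (le_max_right _ _)]
  exact fun i => (abs_le_norm_adaptedMap b 0 z i).trans (h.trans (le_max_left _ _))

theorem integral_hyperplaneMeasure (x : EuclideanSpace ℝ (Fin (n + 1)))
    {φ : EuclideanSpace ℝ (Fin (n + 1)) → ℝ} (hφ : Continuous φ) :
    ∫ y, φ y ∂hyperplaneMeasure b x = ∫ z, φ (x + adaptedMap b (0, z)) :=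
  integral_map (continuous_hyperplane b x).aemeasurable hφ.aestronglyMeasurable

theorem isSpinRep_ujump {Ω : Set (EuclideanSpace ℝ (Fin (n + 1)))} (hΩ : IsOpen Ω)
    (x : EuclideanSpace ℝ (Fin (n + 1))) :
    IsSpinRep Ω (ujump x (b 0)) ((hyperplaneMeasure b x).restrict Ω) fun _ => b 0 := by
  refine ⟨Eventually.of_forall fun y _ => ujump_eq_or x _ y, fun y _ => ?_, ?_, ?_, ?_⟩
  · refine ⟨ball x (dist y x + 1), isOpen_ball.mem_nhds (by simp), ?_⟩
    exact (Measure.restrict_apply_le _ _).trans_lt ((measure_mono ball_subset_closedBall).trans_lt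
      (hyperplaneMeasure_closedBall_lt_top b x _))
  · rw [Measure.restrict_apply hΩ.measurableSet.compl]
    simp
  · exact Eventually.of_forall fun _ => b.norm_eq_one 0
  · intro ψ hψ hc hs e
    rw [integral_ujump_mul_fderiv b x (hψ.of_le (by exact_mod_cast le_top)) hc e,
      setIntegral_eq_integral_of_forall_compl_eq_zero (fun y hy => by
        rw [image_eq_zero_of_notMem_tsupport fun h => hy (hs h), zero_mul]),
      integral_hyperplaneMeasure b x (φ := fun y => ψ y * ⟪b 0, e⟫)
        (hψ.continuous.mul continuous_const)]

end HalfSpace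

section SpinRep

variable {Ω : Set (EuclideanSpace ℝ (Fin d))} {v : EuclideanSpace ℝ (Fin d) → ℝ}
  {σ : Measure (EuclideanSpace ℝ (Fin d))}
  {f : EuclideanSpace ℝ (Fin d) → EuclideanSpace ℝ (Fin d)}

theorem IsSpinRep.measure_lt_top_of_isCompact (h : IsSpinRep Ω v σ f)
    {K : Set (EuclideanSpace ℝ (Fin d))} (hK : IsCompact K) (hKΩ : K ⊆ Ω) : σ K < ⊤ :=
  hK.measure_lt_top_of_nhdsWithin fun y hy => by
    obtain ⟨s, hs, hs'⟩ := h.2.1 y (hKΩ hy)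
    exact ⟨s, mem_nhdsWithin_of_mem_nhds hs, hs'⟩

theorem IsSpinRep.ae_abs_inner_le (h : IsSpinRep Ω v σ f) (e : EuclideanSpace ℝ (Fin d)) :
    ∀ᵐ y ∂σ, |⟪f y, e⟫| ≤ ‖e‖ := by
  filter_upwards [h.2.2.2.1] with y hy
  simpa [hy] using abs_real_inner_le_norm (f y) e

theorem IsSpinRep.integrable_mul_inner (h : IsSpinRep Ω v σ f)
    {ψ : EuclideanSpace ℝ (Fin d) → ℝ} (hψ : Continuous ψ) (hc : HasCompactSupport ψ)
    (hs : tsupport ψ ⊆ Ω) {e : EuclideanSpace ℝ (Fin d)}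
    (hm : AEStronglyMeasurable (fun y => ψ y * ⟪f y, e⟫) σ) :
    Integrable (fun y => ψ y * ⟪f y, e⟫) σ := by
  obtain ⟨M, hM⟩ := hψ.bounded_above_of_compact_support hc
  have hsub : Function.support (fun y => ψ y * ⟪f y, e⟫) ⊆ tsupport ψ :=
    (Function.support_mul_subset_left _ _).trans (subset_tsupport ψ)
  rw [← integrableOn_iff_integrable_of_support_subset hsub]
  refine IntegrableOn.of_bound (h.measure_lt_top_of_isCompact hc hs) hm.restrict (M * ‖e‖)
    (ae_restrict_of_ae ?_)
  filter_upwards [h.ae_abs_inner_le e] with y hy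
  rw [norm_mul]
  exact mul_le_mul (hM y) hy (abs_nonneg _) ((norm_nonneg _).trans (hM y))

theorem fderiv_apply_eq_zero_of_eqOn_ball {ψ : EuclideanSpace ℝ (Fin d) → ℝ} {c r : ℝ}
    {x y : EuclideanSpace ℝ (Fin d)} (h : ∀ z ∈ ball x r, ψ z = c) (hy : y ∈ ball x r)
    (e : EuclideanSpace ℝ (Fin d)) : fderiv ℝ ψ y e = 0 := by
  have : ψ =ᶠ[nhds y] fun _ => c := by
    filter_upwards [isOpen_ball.mem_nhds hy] with z hz using h z hz
  rw [this.fderiv_eq]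
  simp

theorem fderiv_apply_eq_zero_of_notMem {ψ : EuclideanSpace ℝ (Fin d) → ℝ}
    {y : EuclideanSpace ℝ (Fin d)} (h : y ∉ tsupport ψ)
    (e : EuclideanSpace ℝ (Fin d)) : fderiv ℝ ψ y e = 0 := by
  rw [image_eq_zero_of_notMem_tsupport (f := fderiv ℝ ψ) fun h' => h (tsupport_fderiv_subset ℝ h')]
  simp

end SpinRep

section Measurability

variable {n : ℕ} {Ω : Set (EuclideanSpace ℝ (Fin (n + 1)))}
  {v : EuclideanSpace ℝ (Fin (n + 1)) → ℝ} {σ : Measure (EuclideanSpace ℝ (Fin (n + 1)))}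
  {f : EuclideanSpace ℝ (Fin (n + 1)) → EuclideanSpace ℝ (Fin (n + 1))}
  {x ν : EuclideanSpace ℝ (Fin (n + 1))} {r ρ : ℝ}

/-- A spin field agreeing with a half-space configuration on an annulus has a nontrivial
distributional derivative when tested with a cut-off function of the annulus. -/
theorem exists_integral_mul_fderiv_bump (hν : ‖ν‖ = 1)
    (χ : ContDiffBump x) (hv : ∀ᵐ y ∂volume, y ∈ closedBall x χ.rOut → χ.rIn ≤ dist y x →
      v y = ujump x ν y) :
    ∃ I : ℝ, 0 < I ∧ ∀ e, ∫ y, v y * fderiv ℝ χ y e = -2 * (I * ⟪ν, e⟫) := by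
  obtain ⟨b, rfl⟩ := exists_orthonormalBasis_apply_zero hν
  have hcd : ContDiff ℝ 1 χ := χ.contDiff
  refine ⟨∫ z, χ (x + adaptedMap b (0, z)), ?_, fun e => ?_⟩
  · have hc := χ.continuous.comp (continuous_hyperplane b x)
    refine hc.integral_pos_of_hasCompactSupport_nonneg_nonzero
      (HasCompactSupport.comp_adaptedMap b χ.hasCompactSupport x) (fun z => χ.nonneg)
      (x := fun _ => 0) ?_
    have h0 : adaptedMap b (0, fun _ => 0) = 0 := by
      simpa using adaptedMap_inner b 0
    have : χ x = 1 := χ.one_of_mem_closedBall (mem_closedBall_self χ.rIn_pos.le)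
    simp [h0, this]
  · rw [← integral_mul_const, ← integral_ujump_mul_fderiv b x hcd χ.hasCompactSupport e]
    refine integral_congr_ae ?_
    filter_upwards [hv] with y hy
    by_cases h1 : y ∈ closedBall x χ.rOut
    · by_cases h2 : χ.rIn ≤ dist y x
      · rw [hy h1 h2]
      · rw [fderiv_apply_eq_zero_of_eqOn_ball (ψ := χ) (c := 1)
          (fun z hz => χ.one_of_mem_closedBall (ball_subset_closedBall hz))
          (mem_ball.2 (not_le.1 h2)), mul_zero, mul_zero]
    · rw [fderiv_apply_eq_zero_of_notMem (by rwa [χ.tsupport_eq]), mul_zero, mul_zero]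

/-- The normal of a spin field agreeing with a half-space configuration on an annulus is
measurable inside: otherwise the junk value of the Bochner integral would make the distributional
derivative of the spin field vanish. -/
theorem IsSpinRep.aestronglyMeasurable_bump_mul_inner (h : IsSpinRep Ω v σ f) (hν : ‖ν‖ = 1)
    (χ : ContDiffBump x) (hχ : closedBall x χ.rOut ⊆ Ω)
    (hv : ∀ᵐ y ∂volume, y ∈ closedBall x χ.rOut → χ.rIn ≤ dist y x → v y = ujump x ν y)
    (e : EuclideanSpace ℝ (Fin (n + 1))) :
    AEStronglyMeasurable (fun y => χ y * ⟪f y, e⟫) σ := by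
  obtain ⟨I, hI, hP⟩ := exists_integral_mul_fderiv_bump hν χ hv
  have hT : ∀ e', ¬ AEStronglyMeasurable (fun y => χ y * ⟪f y, e'⟫) σ → ⟪ν, e'⟫ = 0 := by
    intro e' hm
    have h5 := h.2.2.2.2 χ χ.contDiff χ.hasCompactSupport (by rwa [χ.tsupport_eq]) e'
    rw [hP e', integral_non_aestronglyMeasurable hm] at h5
    have : I * ⟪ν, e'⟫ = 0 := by linarith
    exact (mul_eq_zero.1 this).resolve_left hI.ne'
  have hνν : ⟪ν, ν⟫ = 1 := by rw [real_inner_self_eq_norm_sq, hν]; norm_num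
  have hmν : AEStronglyMeasurable (fun y => χ y * ⟪f y, ν⟫) σ := by
    by_contra hm
    have := hT ν hm
    linarith
  by_contra hm
  have h1 := hT e hm
  have h2 := hT (e + ν) fun h' => hm <| (h'.sub hmν).congr
    (Eventually.of_forall fun y => by
      simp only [Pi.sub_apply, inner_add_right]
      ring)
  rw [inner_add_right, hνν, h1] at h2
  norm_num at h2

theorem IsSpinRep.aestronglyMeasurable_inner (h : IsSpinRep Ω v σ f) (hν : ‖ν‖ = 1)
    (hr : 0 < r) (hrρ : r < ρ) (hρ : closedBall x ρ ⊆ Ω)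
    (hv : ∀ᵐ y ∂volume, y ∈ closedBall x ρ → r ≤ dist y x → v y = ujump x ν y)
    (e : EuclideanSpace ℝ (Fin (n + 1))) :
    AEStronglyMeasurable (fun y => ⟪f y, e⟫) (σ.restrict (closedBall x r)) := by
  refine (h.aestronglyMeasurable_bump_mul_inner hν ⟨r, ρ, hr, hrρ⟩ hρ hv e).restrict.congr ?_
  filter_upwards [ae_restrict_mem isClosed_closedBall.measurableSet] with y hy
  rw [ContDiffBump.one_of_mem_closedBall _ hy, one_mul]

theorem IsSpinRep.aestronglyMeasurable_ball (h : IsSpinRep Ω v σ f) (hν : ‖ν‖ = 1)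
    {s : ℝ} (hs : 0 < s) (hsr : s < r) (hrρ : r < ρ) (hρ : closedBall x ρ ⊆ Ω)
    (hv : ∀ᵐ y ∂volume, y ∈ closedBall x ρ → r ≤ dist y x → v y = ujump x ν y) :
    AEStronglyMeasurable v (volume.restrict (ball x s)) := by
  set χ : ContDiffBump x := ⟨r, ρ, hs.trans hsr, hrρ⟩ with hχdef
  set η : ContDiffBump x := ⟨s, r, hs, hsr⟩ with hηdef
  have hνν : ⟪ν, ν⟫ = 1 := by rw [real_inner_self_eq_norm_sq, hν]; norm_num
  obtain ⟨I, hI, hP⟩ := exists_integral_mul_fderiv_bump hν χ hv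
  have hχΩ : tsupport χ ⊆ Ω := by rwa [χ.tsupport_eq]
  have hmχ := h.aestronglyMeasurable_bump_mul_inner hν χ hρ hv ν
  have hiχ := h.integrable_mul_inner χ.continuous χ.hasCompactSupport hχΩ hmχ
  set ψ : EuclideanSpace ℝ (Fin (n + 1)) → ℝ := fun y => η y * ⟪y - x, ν⟫ with hψdef
  have hψ : ContDiff ℝ (⊤ : ℕ∞) ψ :=
    η.contDiff.mul ((contDiff_id.sub contDiff_const).inner ℝ contDiff_const)
  have hψs : tsupport ψ ⊆ closedBall x r := by
    rw [← η.tsupport_eq]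
    exact tsupport_mul_subset_left
  have hψc : HasCompactSupport ψ := η.hasCompactSupport.mul_right
  have hψχ : ∀ y, ψ y = ψ y * χ y := fun y => by
    by_cases hy : y ∈ closedBall x r
    · rw [χ.one_of_mem_closedBall hy, mul_one]
    · rw [image_eq_zero_of_notMem_tsupport fun h' => hy (hψs h'), zero_mul]
  have hψΩ : tsupport ψ ⊆ Ω := hψs.trans ((closedBall_subset_closedBall hrρ.le).trans hρ)
  have hmψ : AEStronglyMeasurable (fun y => ψ y * ⟪f y, ν⟫) σ := by
    refine (hψ.continuous.aestronglyMeasurable.mul hmχ).congr (Eventually.of_forall fun y => ?_)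
    simp only [Pi.mul_apply]
    rw [← mul_assoc, ← hψχ]
  have hiψ := h.integrable_mul_inner hψ.continuous hψc hψΩ hmψ
  have hvχ : AEStronglyMeasurable (fun y => v y * fderiv ℝ χ y ν) volume := by
    by_contra hm
    have := hP ν
    rw [integral_non_aestronglyMeasurable hm, hνν] at this
    linarith
  have hmv : AEStronglyMeasurable (fun y => v y * fderiv ℝ ψ y ν) volume := by
    by_contra hm
    have key : ∀ s : ℝ, s ≠ 0 →
        ∫ y, χ y * ⟪f y, ν⟫ ∂σ + s * ∫ y, ψ y * ⟪f y, ν⟫ ∂σ = 0 := by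
      intro s hs
      have h5 := h.2.2.2.2 (fun y => χ y + s * ψ y) (χ.contDiff.add (contDiff_const.mul hψ))
        (χ.hasCompactSupport.add hψc.mul_left)
        ((tsupport_add _ _).trans (Set.union_subset hχΩ (tsupport_mul_subset_right.trans hψΩ))) ν
      have hfd : ∀ y, fderiv ℝ (fun y => χ y + s * ψ y) y ν =
          fderiv ℝ χ y ν + s * fderiv ℝ ψ y ν := by
        intro y
        have h1 : DifferentiableAt ℝ χ y := (χ.contDiff (n := 1)).differentiable one_ne_zero y
        have h2 : DifferentiableAt ℝ ψ y := hψ.differentiable (by simp) y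
        rw [fderiv_fun_add h1 (h2.const_mul s), fderiv_const_mul h2]
        simp
      rw [integral_non_aestronglyMeasurable] at h5
      · simp only [add_mul, mul_assoc] at h5
        rw [integral_add hiχ (hiψ.const_mul s), integral_const_mul] at h5
        linarith
      · intro h'
        refine hm (((h'.sub hvχ).const_mul s⁻¹).congr (Eventually.of_forall fun y => ?_))
        simp only [Pi.sub_apply, hfd]
        field_simp
        ring
    have k1 := key 1 one_ne_zero
    have k2 := key 2 two_ne_zero
    have h0 : ∫ y, χ y * ⟪f y, ν⟫ ∂σ = 0 := by linarith
    have h5 := h.2.2.2.2 χ χ.contDiff χ.hasCompactSupport hχΩ ν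
    rw [hP ν, h0, hνν] at h5
    linarith
  refine hmv.restrict.congr ?_
  filter_upwards [ae_restrict_mem measurableSet_ball] with y hy
  have : ψ =ᶠ[nhds y] fun z => ⟪z - x, ν⟫ := by
    filter_upwards [isOpen_ball.mem_nhds hy] with z hz
    simp only [hψdef]
    rw [η.one_of_mem_closedBall (ball_subset_closedBall hz), one_mul]
  rw [this.fderiv_eq]
  have hd : HasFDerivAt (fun z => ⟪z - x, ν⟫) (innerSL ℝ ν) y := by
    have := ((innerSL ℝ ν).hasFDerivAt (x := y)).sub_const ⟪ν, x⟫
    refine this.congr_of_eventuallyEq (Eventually.of_forall fun z => ?_)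
    simp [real_inner_comm, inner_sub_right]
  rw [hd.fderiv, innerSL_apply_apply, hνν, mul_one]

end Measurability

section Polar

variable {n : ℕ}

theorem integral_eq_integral_toSphere {F : EuclideanSpace ℝ (Fin (n + 1)) → ℝ}
    (hF : Integrable F) :
    ∫ y, F y = ∫ ω : sphere (0 : EuclideanSpace ℝ (Fin (n + 1))) 1,
      (∫ t in Set.Ioi (0 : ℝ), t ^ n * F (t • (ω : EuclideanSpace ℝ (Fin (n + 1)))))
      ∂(volume : Measure (EuclideanSpace ℝ (Fin (n + 1)))).toSphere := by
  set μ : Measure (EuclideanSpace ℝ (Fin (n + 1))) := volume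
  have hmp := μ.measurePreserving_homeomorphUnitSphereProd
  have hemb := (homeomorphUnitSphereProd (EuclideanSpace ℝ (Fin (n + 1)))).measurableEmbedding
  set G : sphere (0 : EuclideanSpace ℝ (Fin (n + 1))) 1 × Set.Ioi (0 : ℝ) → ℝ :=
    fun p => F (p.2.1 • p.1.1) with hG
  have hGcomp :
      G ∘ homeomorphUnitSphereProd (EuclideanSpace ℝ (Fin (n + 1))) = F ∘ Subtype.val := by
    funext y
    have : ‖y.1‖ ≠ 0 := norm_ne_zero_iff.2 y.2
    simp [hG, smul_smul, this]
  have hGint : Integrable G (μ.toSphere.prod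
      (.volumeIoiPow (Module.finrank ℝ (EuclideanSpace ℝ (Fin (n + 1))) - 1))) := by
    rw [← hmp.integrable_comp_emb hemb, hGcomp]
    rw [← integrableOn_iff_comap_subtypeVal (measurableSet_singleton _).compl]
    exact hF.integrableOn
  calc ∫ y, F y ∂μ = ∫ y : ({0}ᶜ : Set (EuclideanSpace ℝ (Fin (n + 1)))), F y.1 ∂(μ.comap (↑)) := by
        rw [integral_subtype_comap (measurableSet_singleton _).compl fun y ↦ F y,
          restrict_compl_singleton]
    _ = ∫ p, G p ∂(μ.toSphere.prod
          (.volumeIoiPow (Module.finrank ℝ (EuclideanSpace ℝ (Fin (n + 1))) - 1))) := by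
        rw [← hmp.integral_comp hemb]
        exact congrArg (fun φ => ∫ y, φ y ∂(μ.comap (↑))) hGcomp.symm
    _ = _ := by
        rw [integral_prod _ hGint]
        congr 1
        funext ω
        simp only [Measure.volumeIoiPow, ENNReal.ofReal, finrank_euclideanSpace_fin,
          Nat.add_sub_cancel, hG]
        rw [integral_withDensity_eq_integral_smul,
          integral_subtype_comap measurableSet_Ioi fun t : ℝ => Real.toNNReal (t ^ n) • F (t • ω.1),
          setIntegral_congr_fun measurableSet_Ioi fun t ht ↦ ?_]
        · rw [NNReal.smul_def, Real.coe_toNNReal _ (pow_nonneg (le_of_lt ht) _), smul_eq_mul]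
        · exact (measurable_subtype_coe.pow_const _).real_toNNReal

/-- Smooth radial functions equal to `1` on `closedBall x r` and decreasing to its indicator as
`k → ∞`. -/
noncomputable def radialCutoff (x : EuclideanSpace ℝ (Fin d)) (r : ℝ) (k : ℕ)
    (y : EuclideanSpace ℝ (Fin d)) : ℝ :=
  1 - Real.smoothTransition (k * (‖y - x‖ ^ 2 - r ^ 2))

variable {x : EuclideanSpace ℝ (Fin d)} {r : ℝ}

theorem contDiff_radialCutoff (k : ℕ) : ContDiff ℝ (⊤ : ℕ∞) (radialCutoff x r k) :=
  contDiff_const.sub (Real.smoothTransition.contDiff.comp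
    (contDiff_const.mul (((contDiff_id.sub contDiff_const).norm_sq ℝ).sub contDiff_const)))

theorem radialCutoff_nonneg (k : ℕ) (y : EuclideanSpace ℝ (Fin d)) : 0 ≤ radialCutoff x r k y :=
  sub_nonneg.2 (Real.smoothTransition.le_one _)

theorem radialCutoff_le_one (k : ℕ) (y : EuclideanSpace ℝ (Fin d)) : radialCutoff x r k y ≤ 1 :=
  sub_le_self _ (Real.smoothTransition.nonneg _)

theorem smoothTransition_cutoff_eq_zero {t : ℝ} (ht : 0 ≤ t) (h : t ≤ r) (k : ℕ) :
    Real.smoothTransition (k * (t ^ 2 - r ^ 2)) = 0 := by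
  refine Real.smoothTransition.zero_of_nonpos
    (mul_nonpos_of_nonneg_of_nonpos k.cast_nonneg ?_)
  nlinarith

theorem eventually_smoothTransition_cutoff_eq_one {t : ℝ} (hr : 0 ≤ r) (h : r < t) :
    ∀ᶠ k : ℕ in atTop, ∀ s, t ≤ s → Real.smoothTransition (k * (s ^ 2 - r ^ 2)) = 1 := by
  have hpos : 0 < t ^ 2 - r ^ 2 := by nlinarith
  filter_upwards [eventually_ge_atTop ⌈(t ^ 2 - r ^ 2)⁻¹⌉₊] with k hk s hs
  refine Real.smoothTransition.one_of_one_le ?_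
  have h1 : (t ^ 2 - r ^ 2)⁻¹ ≤ k := Nat.ceil_le.1 hk
  calc (1 : ℝ) = (t ^ 2 - r ^ 2)⁻¹ * (t ^ 2 - r ^ 2) := (inv_mul_cancel₀ hpos.ne').symm
    _ ≤ k * (s ^ 2 - r ^ 2) := mul_le_mul h1 (by nlinarith) hpos.le k.cast_nonneg

theorem radialCutoff_eq_one {y : EuclideanSpace ℝ (Fin d)} (hy : y ∈ closedBall x r) (k : ℕ) :
    radialCutoff x r k y = 1 := by
  rw [radialCutoff, smoothTransition_cutoff_eq_zero (norm_nonneg _)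
    (by rwa [← dist_eq_norm]), sub_zero]

theorem eventually_radialCutoff_eq_zero {t : ℝ} (hr : 0 ≤ r) (h : r < t) :
    ∀ᶠ k : ℕ in atTop, ∀ y, t ≤ dist y x → radialCutoff x r k y = 0 := by
  filter_upwards [eventually_smoothTransition_cutoff_eq_one hr h] with k hk y hy
  rw [radialCutoff, hk _ (by rwa [← dist_eq_norm]), sub_self]

theorem tendsto_radialCutoff (hr : 0 ≤ r) (y : EuclideanSpace ℝ (Fin d)) :
    Tendsto (fun k => radialCutoff x r k y) atTop
      (nhds ((closedBall x r).indicator (fun _ => 1) y)) := by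
  by_cases hy : y ∈ closedBall x r
  · simp [hy, radialCutoff_eq_one hy]
  · rw [Set.indicator_of_notMem hy]
    refine tendsto_const_nhds.congr' ?_
    filter_upwards [eventually_radialCutoff_eq_zero hr (not_le.1 fun h => hy h)] with k hk
    exact (hk y le_rfl).symm

theorem hasDerivAt_smoothTransition_cutoff (k : ℕ) (t : ℝ) :
    HasDerivAt (fun t : ℝ => 1 - Real.smoothTransition (k * (t ^ 2 - r ^ 2)))
      (-(deriv Real.smoothTransition (k * (t ^ 2 - r ^ 2)) * (k * (2 * t)))) t := by
  have h1 : HasDerivAt (fun t : ℝ => (k : ℝ) * (t ^ 2 - r ^ 2)) (k * (2 * t)) t := by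
    simpa using (((hasDerivAt_id t).pow 2).sub_const (r ^ 2)).const_mul (k : ℝ)
  have h2 : HasDerivAt Real.smoothTransition
      (deriv Real.smoothTransition (k * (t ^ 2 - r ^ 2))) (k * (t ^ 2 - r ^ 2)) :=
    ((Real.smoothTransition.contDiff (n := 1)).differentiable one_ne_zero _).hasDerivAt
  exact (h2.comp t h1).const_sub 1

theorem fderiv_radialCutoff (k : ℕ) (y e : EuclideanSpace ℝ (Fin d)) :
    fderiv ℝ (radialCutoff x r k) y e =
      -(deriv Real.smoothTransition (k * (‖y - x‖ ^ 2 - r ^ 2)) * (k * (2 * ⟪y - x, e⟫))) := by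
  have h1 : HasFDerivAt (fun y => (k : ℝ) * (‖y - x‖ ^ 2 - r ^ 2))
      ((k : ℝ) • (2 • (innerSL ℝ (y - x)).comp (ContinuousLinearMap.id ℝ _))) y :=
    ((((hasFDerivAt_id y).sub_const x).norm_sq).sub_const (r ^ 2)).const_mul (k : ℝ)
  have h2 : HasDerivAt Real.smoothTransition
      (deriv Real.smoothTransition (k * (‖y - x‖ ^ 2 - r ^ 2))) (k * (‖y - x‖ ^ 2 - r ^ 2)) :=
    ((Real.smoothTransition.contDiff (n := 1)).differentiable one_ne_zero _).hasDerivAt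
  have h3 := (h2.comp_hasFDerivAt y h1).const_sub 1
  have h4 : HasFDerivAt (radialCutoff x r k) _ y := h3
  rw [h4.fderiv]
  simp only [neg_apply, smul_apply, ContinuousLinearMap.comp_id, innerSL_apply_apply, smul_eq_mul,
    nsmul_eq_mul, Nat.cast_ofNat]

theorem integral_mul_deriv_cutoff {G G' : ℝ → ℝ} (hG : ∀ t, HasDerivAt G (G' t) t)
    (hG' : Continuous G') {R : ℝ} (hr : 0 < r) (hGR : G R = 0) (k : ℕ) :
    ∫ t in (0 : ℝ)..R, G t * -(deriv Real.smoothTransition (k * (t ^ 2 - r ^ 2)) * (k * (2 * t))) =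
      - G 0 - ∫ t in (0 : ℝ)..R, G' t * (1 - Real.smoothTransition (k * (t ^ 2 - r ^ 2))) := by
  have hc : Continuous (deriv Real.smoothTransition) :=
    (Real.smoothTransition.contDiff (n := 1)).continuous_deriv le_rfl
  rw [intervalIntegral.integral_mul_deriv_eq_deriv_mul (fun t _ => hG t)
    (fun t _ => hasDerivAt_smoothTransition_cutoff (r := r) k t) (hG'.intervalIntegrable _ _)
    (Continuous.intervalIntegrable (by fun_prop) _ _), hGR,
    smoothTransition_cutoff_eq_zero le_rfl hr.le]
  simp

theorem tendsto_integral_mul_deriv_cutoff {G G' : ℝ → ℝ} (hG : ∀ t, HasDerivAt G (G' t) t)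
    (hG' : Continuous G') {R : ℝ} (hr : 0 < r) (hrR : r < R) (hGR : G R = 0) :
    Tendsto (fun k : ℕ => ∫ t in (0 : ℝ)..R,
      G t * -(deriv Real.smoothTransition (k * (t ^ 2 - r ^ 2)) * (k * (2 * t)))) atTop
      (nhds (- G r)) := by
  simp_rw [integral_mul_deriv_cutoff hG hG' hr hGR]
  have hlim : Tendsto (fun k : ℕ => ∫ t in (0 : ℝ)..R,
      G' t * (1 - Real.smoothTransition (k * (t ^ 2 - r ^ 2)))) atTop
      (nhds (∫ t in (0 : ℝ)..R, (Set.Iic r).indicator G' t)) := by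
    have hst : Continuous Real.smoothTransition := Real.smoothTransition.continuous
    refine intervalIntegral.tendsto_integral_filter_of_dominated_convergence (fun t => ‖G' t‖)
      (Eventually.of_forall fun k => Continuous.aestronglyMeasurable (by fun_prop))
      (Eventually.of_forall fun k => Eventually.of_forall fun t _ => ?_)
      (hG'.norm.intervalIntegrable _ _) (Eventually.of_forall fun t ht => ?_)
    · rw [norm_mul, Real.norm_eq_abs (1 - _), abs_of_nonneg
        (sub_nonneg.2 (Real.smoothTransition.le_one _))]
      exact mul_le_of_le_one_right (norm_nonneg _) (sub_le_self _ (Real.smoothTransition.nonneg _))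
    · rw [Set.uIoc_of_le (hr.trans hrR).le] at ht
      by_cases h : t ≤ r
      · simp [smoothTransition_cutoff_eq_zero ht.1.le h, Set.indicator_of_mem (Set.mem_Iic.2 h)]
      · rw [Set.indicator_of_notMem (by simpa using h)]
        refine tendsto_const_nhds.congr' ?_
        filter_upwards [eventually_smoothTransition_cutoff_eq_one hr.le (not_le.1 h)] with k hk
        rw [hk t le_rfl, sub_self, mul_zero]
  have hval : ∫ t in (0 : ℝ)..R, (Set.Iic r).indicator G' t = G r - G 0 := by
    rw [← intervalIntegral.integral_eq_sub_of_hasDerivAt (fun t _ => hG t)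
      (hG'.intervalIntegrable 0 r), intervalIntegral.integral_of_le (hr.trans hrR).le,
      intervalIntegral.integral_of_le hr.le, setIntegral_indicator measurableSet_Iic]
    congr 2
    ext t
    simp only [Set.mem_inter_iff, Set.mem_Ioc, Set.mem_Iic]
    constructor
    · rintro ⟨⟨h1, _⟩, h2⟩; exact ⟨h1, h2⟩
    · rintro ⟨h1, h2⟩; exact ⟨⟨h1, h2.trans hrR.le⟩, h2⟩
  have := (tendsto_const_nhds (x := -G 0)).sub hlim
  rwa [hval, show -G 0 - (G r - G 0) = - G r by ring] at this

end Polar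

section PolarLimit

variable {n : ℕ} {x : EuclideanSpace ℝ (Fin (n + 1))} {r : ℝ}

theorem integrable_mul_fderiv_radialCutoff {A : EuclideanSpace ℝ (Fin (n + 1)) → ℝ}
    (hA : Measurable A) {M : ℝ} (hM : ∀ y, |A y| ≤ M)
    {ψ : EuclideanSpace ℝ (Fin (n + 1)) → ℝ} (hψ : Continuous ψ) (hc : HasCompactSupport ψ)
    (k : ℕ) (e : EuclideanSpace ℝ (Fin (n + 1))) :
    Integrable fun y => A y * (ψ y * fderiv ℝ (radialCutoff x r k) y e) := by
  have h1 : Continuous fun y => fderiv ℝ (radialCutoff x r k) y e :=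
    continuous_fderiv_apply_const ((contDiff_radialCutoff k).of_le (by simp)) e
  exact ((hψ.mul h1).integrable_of_hasCompactSupport hc.mul_right).bdd_mul
    hA.aestronglyMeasurable (Eventually.of_forall hM)

theorem setIntegral_polar_cutoff {A ψ : EuclideanSpace ℝ (Fin (n + 1)) → ℝ}
    (hhom : ∀ t : ℝ, 0 < t → ∀ y, A (t • y) = A y) {R : ℝ} (hR : 0 ≤ R)
    (hψR : ∀ y, R ≤ dist y x → ψ y = 0) (k : ℕ) {ω : EuclideanSpace ℝ (Fin (n + 1))}
    (hω : ‖ω‖ = 1) (e : EuclideanSpace ℝ (Fin (n + 1))) :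
    ∫ t in Set.Ioi (0 : ℝ), t ^ n * (A (x + t • ω - x) *
      (ψ (x + t • ω) * fderiv ℝ (radialCutoff x r k) (x + t • ω) e)) =
    A ω * ⟪ω, e⟫ * ∫ t in (0 : ℝ)..R, t ^ n * ψ (x + t • ω) *
      -(deriv Real.smoothTransition (k * (t ^ 2 - r ^ 2)) * (k * (2 * t))) := by
  have h0 : ∀ t ∈ Set.Ioi (0 : ℝ) \ Set.Ioc 0 R, t ^ n * (A (x + t • ω - x) *
      (ψ (x + t • ω) * fderiv ℝ (radialCutoff x r k) (x + t • ω) e)) = 0 := by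
    rintro t ⟨ht, htR⟩
    have ht' : (0 : ℝ) < t := ht
    rw [hψR _ (by
      rw [dist_eq_norm, add_sub_cancel_left, norm_smul, hω, mul_one, Real.norm_of_nonneg ht'.le]
      exact (not_le.1 fun h => htR ⟨ht, h⟩).le)]
    simp
  rw [setIntegral_eq_of_subset_of_forall_sdiff_eq_zero measurableSet_Ioi
    Set.Ioc_subset_Ioi_self h0, intervalIntegral.integral_of_le hR, ← integral_const_mul]
  refine setIntegral_congr_fun measurableSet_Ioc fun t ht => ?_
  have ht' : 0 < t := ht.1
  simp only [fderiv_radialCutoff, add_sub_cancel_left, hhom t ht', norm_smul, hω, mul_one,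
    Real.norm_of_nonneg ht'.le, real_inner_smul_left]
  ring

theorem tendsto_integral_mul_fderiv_radialCutoff {A : EuclideanSpace ℝ (Fin (n + 1)) → ℝ}
    (hA : Measurable A) {M : ℝ} (hM : ∀ y, |A y| ≤ M)
    (hhom : ∀ t : ℝ, 0 < t → ∀ y, A (t • y) = A y)
    {ψ : EuclideanSpace ℝ (Fin (n + 1)) → ℝ} (hψ : ContDiff ℝ 1 ψ) (hc : HasCompactSupport ψ)
    (hr : 0 < r) (e : EuclideanSpace ℝ (Fin (n + 1))) :
    Tendsto (fun k : ℕ => ∫ y, A (y - x) * (ψ y * fderiv ℝ (radialCutoff x r k) y e)) atTop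
      (nhds (∫ ω : sphere (0 : EuclideanSpace ℝ (Fin (n + 1))) 1,
        A ω * ⟪(ω : EuclideanSpace ℝ (Fin (n + 1))), e⟫ * -(r ^ n * ψ (x + r • ω.1))
        ∂(volume : Measure (EuclideanSpace ℝ (Fin (n + 1)))).toSphere)) := by
  obtain ⟨R, hrR, hR⟩ : ∃ R, r < R ∧ ∀ y, R ≤ dist y x → ψ y = 0 := by
    obtain ⟨R, hR⟩ := hc.isCompact.isBounded.subset_ball x
    refine ⟨max R (r + 1), (lt_add_one r).trans_le (le_max_right _ _), fun y hy => ?_⟩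
    exact image_eq_zero_of_notMem_tsupport fun h =>
      absurd (hR h) (not_lt.2 ((le_max_left _ _).trans hy))
  have hR0 : 0 < R := hr.trans hrR
  set G : EuclideanSpace ℝ (Fin (n + 1)) → ℝ → ℝ := fun ω t => t ^ n * ψ (x + t • ω) with hG
  set G' : EuclideanSpace ℝ (Fin (n + 1)) → ℝ → ℝ := fun ω t =>
    n * t ^ (n - 1) * ψ (x + t • ω) + t ^ n * fderiv ℝ ψ (x + t • ω) ω with hG'
  have hGd : ∀ ω t, HasDerivAt (G ω) (G' ω t) t := fun ω t => by
    have h1 : HasDerivAt (fun t : ℝ => x + t • ω) ω t := by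
      simpa using ((hasDerivAt_id t).smul_const ω).const_add x
    exact (hasDerivAt_pow n t).mul
      (((hψ.differentiable one_ne_zero _).hasFDerivAt).comp_hasDerivAt t h1)
  have hψc := hψ.continuous
  have hψ'c := hψ.continuous_fderiv one_ne_zero
  have hG'c : Continuous fun p : EuclideanSpace ℝ (Fin (n + 1)) × ℝ => G' p.1 p.2 := by
    have h1 : Continuous fun p : EuclideanSpace ℝ (Fin (n + 1)) × ℝ =>
        fderiv ℝ ψ (x + p.2 • p.1) p.1 :=
      (hψ'c.comp (by fun_prop)).clm_apply continuous_fst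
    simp only [hG']
    fun_prop
  have hst : Continuous Real.smoothTransition := Real.smoothTransition.continuous
  obtain ⟨B, hB⟩ := ((isCompact_sphere (0 : EuclideanSpace ℝ (Fin (n + 1))) 1).prod
    (isCompact_Icc (a := (0 : ℝ)) (b := R))).exists_bound_of_continuousOn hG'c.continuousOn
  have hGR : ∀ ω : sphere (0 : EuclideanSpace ℝ (Fin (n + 1))) 1, G ω R = 0 := fun ω => by
    have : ψ (x + R • ω.1) = 0 := hR _ (by
      simp [dist_eq_norm, norm_smul, abs_of_pos hR0])
    simp [hG, this]
  have hJ : ∀ k : ℕ, ∫ y, A (y - x) * (ψ y * fderiv ℝ (radialCutoff x r k) y e) =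
      ∫ ω : sphere (0 : EuclideanSpace ℝ (Fin (n + 1))) 1,
        A ω * ⟪(ω : EuclideanSpace ℝ (Fin (n + 1))), e⟫ *
          (- G ω 0 - ∫ t in (0 : ℝ)..R, G' ω t * (1 - Real.smoothTransition (k * (t ^ 2 - r ^ 2))))
        ∂(volume : Measure (EuclideanSpace ℝ (Fin (n + 1)))).toSphere := fun k => by
    rw [← integral_add_left_eq_self _ x, integral_eq_integral_toSphere]
    · congr 1
      funext ω
      rw [setIntegral_polar_cutoff hhom hR0.le hR k (by simp) e,
        ← integral_mul_deriv_cutoff (hGd ω) (hG'c.comp (by fun_prop : Continuous fun t : ℝ =>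
          ((ω : EuclideanSpace ℝ (Fin (n + 1))), t))) hr (hGR ω) k]
    · exact (integrable_mul_fderiv_radialCutoff (A := fun y => A (y - x))
        (hA.comp (measurable_id.sub_const x)) (fun y => hM _) hψ.continuous hc k e).comp_add_left x
  simp_rw [hJ]
  have hM0 : 0 ≤ M := (abs_nonneg _).trans (hM 0)
  have hin : ∀ ω : sphere (0 : EuclideanSpace ℝ (Fin (n + 1))) 1,
      |⟪(ω : EuclideanSpace ℝ (Fin (n + 1))), e⟫| ≤ ‖e‖ := fun ω => by
    simpa using abs_real_inner_le_norm (ω : EuclideanSpace ℝ (Fin (n + 1))) e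
  obtain ⟨B₀, hB₀⟩ := hc.exists_bound_of_continuous hψ.continuous
  refine tendsto_integral_of_dominated_convergence (fun _ => M * ‖e‖ * ((0 ^ n * B₀) + B * R))
    (fun k => ?_) (integrable_const _) (fun k => Eventually.of_forall fun ω => ?_)
    (Eventually.of_forall fun ω => ?_)
  · have h1 : Continuous fun ω : EuclideanSpace ℝ (Fin (n + 1)) =>
        ∫ t in (0 : ℝ)..R, G' ω t * (1 - Real.smoothTransition (k * (t ^ 2 - r ^ 2))) := by
      refine intervalIntegral.continuous_parametric_intervalIntegral_of_continuous' ?_ _ _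
      exact hG'c.mul (by fun_prop)
    have h2 : Continuous fun ω : EuclideanSpace ℝ (Fin (n + 1)) => G ω 0 := by
      simp only [hG]; fun_prop
    have h3 := (h2.neg.sub h1).comp (continuous_subtype_val
      (p := fun y => y ∈ sphere (0 : EuclideanSpace ℝ (Fin (n + 1))) 1))
    have h4 : Continuous fun ω : sphere (0 : EuclideanSpace ℝ (Fin (n + 1))) 1 =>
      ⟪(ω : EuclideanSpace ℝ (Fin (n + 1))), e⟫ := by fun_prop
    exact (((hA.comp measurable_subtype_coe).mul h4.measurable).mul
      h3.measurable).aestronglyMeasurable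
  · rw [norm_mul, norm_mul]
    refine mul_le_mul (mul_le_mul (hM _) (hin ω) (abs_nonneg _) hM0) ?_ (norm_nonneg _)
      (mul_nonneg hM0 (norm_nonneg _))
    refine (norm_sub_le _ _).trans (add_le_add ?_ ?_)
    · rw [norm_neg, norm_mul, Real.norm_of_nonneg (by positivity)]
      exact mul_le_mul_of_nonneg_left (hB₀ _) (by positivity)
    · have := intervalIntegral.norm_integral_le_of_norm_le_const (a := 0) (b := R) (C := B)
        (f := fun t => G' ω t * (1 - Real.smoothTransition (k * (t ^ 2 - r ^ 2)))) fun t ht => by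
          rw [Set.uIoc_of_le hR0.le] at ht
          rw [norm_mul, Real.norm_eq_abs (1 - _), abs_of_nonneg
            (sub_nonneg.2 (Real.smoothTransition.le_one _))]
          exact (mul_le_of_le_one_right (norm_nonneg _)
            (sub_le_self _ (Real.smoothTransition.nonneg _))).trans
              (hB (ω, t) ⟨ω.2, ht.1.le, ht.2⟩)
      simpa [abs_of_pos hR0] using this
  · refine Tendsto.const_mul _ ?_
    have h := tendsto_integral_mul_deriv_cutoff (hGd ω) (hG'c.comp
      (by fun_prop : Continuous fun t : ℝ =>
          ((ω : EuclideanSpace ℝ (Fin (n + 1))), t))) hr hrR (hGR ω)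
    refine h.congr fun k => ?_
    exact integral_mul_deriv_cutoff (hGd ω) (hG'c.comp (by fun_prop : Continuous fun t : ℝ =>
          ((ω : EuclideanSpace ℝ (Fin (n + 1))), t))) hr (hGR ω) k

end PolarLimit

section Gluing

variable {n : ℕ} {x : EuclideanSpace ℝ (Fin d)} {r : ℝ}

theorem tendsto_integral_radialCutoff_mul (hr : 0 ≤ r) {μ : Measure (EuclideanSpace ℝ (Fin d))}
    {φ : EuclideanSpace ℝ (Fin d) → ℝ} (hφ : Integrable φ μ) :
    Tendsto (fun k => ∫ y, radialCutoff x r k y * φ y ∂μ) atTop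
      (nhds (∫ y in closedBall x r, φ y ∂μ)) := by
  rw [← integral_indicator isClosed_closedBall.measurableSet]
  refine tendsto_integral_of_dominated_convergence (fun y => ‖φ y‖)
    (fun k => (contDiff_radialCutoff k).continuous.aestronglyMeasurable.mul hφ.1) hφ.norm
    (fun k => Eventually.of_forall fun y => ?_) (Eventually.of_forall fun y => ?_)
  · rw [norm_mul, Real.norm_of_nonneg (radialCutoff_nonneg k y)]
    exact mul_le_of_le_one_left (norm_nonneg _) (radialCutoff_le_one k y)
  · convert (tendsto_radialCutoff hr y).mul_const (φ y) using 2
    by_cases hy : y ∈ closedBall x r <;> simp [hy, Set.indicator]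

theorem integrable_radialCutoff_mul {μ : Measure (EuclideanSpace ℝ (Fin d))}
    {φ : EuclideanSpace ℝ (Fin d) → ℝ} (hφ : Integrable φ μ) (k : ℕ) :
    Integrable (fun y => radialCutoff x r k y * φ y) μ :=
  hφ.bdd_mul (c := 1) (contDiff_radialCutoff k).continuous.aestronglyMeasurable
    (Eventually.of_forall fun y => by
      rw [Real.norm_of_nonneg (radialCutoff_nonneg k y)]; exact radialCutoff_le_one k y)

theorem tendsto_integral_one_sub_radialCutoff_mul (hr : 0 ≤ r)
    {μ : Measure (EuclideanSpace ℝ (Fin d))}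
    {φ : EuclideanSpace ℝ (Fin d) → ℝ} (hφ : Integrable φ μ) :
    Tendsto (fun k => ∫ y, (1 - radialCutoff x r k y) * φ y ∂μ) atTop
      (nhds (∫ y in (closedBall x r)ᶜ, φ y ∂μ)) := by
  have h := (tendsto_integral_radialCutoff_mul (x := x) hr hφ).const_sub (∫ y, φ y ∂μ)
  rw [← setIntegral_compl isClosed_closedBall.measurableSet hφ] at h
  refine h.congr fun k => ?_
  rw [← integral_sub hφ (integrable_radialCutoff_mul hφ k)]
  exact integral_congr_ae (Eventually.of_forall fun y => by ring)

theorem eventually_fderiv_radialCutoff_mul_eq_zero (hr : 0 ≤ r) {t : ℝ} (h : r < t)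
    (ψ : EuclideanSpace ℝ (Fin d) → ℝ) :
    ∀ᶠ k : ℕ in atTop, ∀ y, t ≤ dist y x → ∀ e,
      fderiv ℝ (fun y => radialCutoff x r k y * ψ y) y e = 0 := by
  obtain ⟨s, hrs, hst⟩ := exists_between h
  filter_upwards [eventually_radialCutoff_eq_zero (x := x) hr hrs] with k hk y hy e
  refine fderiv_apply_eq_zero_of_notMem (fun hmem => ?_) e
  have hsub : tsupport (fun y => radialCutoff x r k y * ψ y) ⊆ closedBall x s := by
    refine closure_minimal (fun z hz => ?_) isClosed_closedBall
    by_contra hzs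
    exact hz (by simp [hk z (not_le.1 hzs).le])
  exact absurd (mem_closedBall.1 (hsub hmem)) (not_le.2 (hst.trans_le hy))

theorem fderiv_mul_apply_eq {η ψ : EuclideanSpace ℝ (Fin d) → ℝ} (hη : ContDiff ℝ (⊤ : ℕ∞) η)
    (hψ : ContDiff ℝ (⊤ : ℕ∞) ψ) (y e : EuclideanSpace ℝ (Fin d)) :
    fderiv ℝ (fun y => η y * ψ y) y e = η y * fderiv ℝ ψ y e + ψ y * fderiv ℝ η y e := by
  rw [fderiv_fun_mul (hη.differentiable (by simp) y) (hψ.differentiable (by simp) y)]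
  simp

theorem ujump_eq_ujump_zero (x ν y : EuclideanSpace ℝ (Fin d)) :
    ujump x ν y = ujump 0 ν (y - x) := by
  simp [ujump]

theorem ujump_zero_smul (ν y : EuclideanSpace ℝ (Fin d)) {t : ℝ} (ht : 0 < t) :
    ujump 0 ν (t • y) = ujump 0 ν y := by
  simp [ujump, real_inner_smul_left, ht]

theorem eventually_ae_jump_eq {ν₁ ν₂ : EuclideanSpace ℝ (Fin d)}
    {v : EuclideanSpace ℝ (Fin d) → ℝ} {ρ t : ℝ} (hr : 0 ≤ r) (hrt : r < t) (htρ : t ≤ ρ)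
    (hv : ∀ᵐ y ∂volume, y ∈ closedBall x ρ → r ≤ dist y x → v y = ujump x ν₁ y)
    (ψ : EuclideanSpace ℝ (Fin d) → ℝ) (e : EuclideanSpace ℝ (Fin d)) :
    ∀ᶠ k : ℕ in atTop, ∀ᵐ y ∂volume,
      ((ball x t).indicator v y - ujump x ν₂ y) * (ψ y * fderiv ℝ (radialCutoff x r k) y e) =
      (ujump 0 ν₁ (y - x) - ujump 0 ν₂ (y - x)) * (ψ y * fderiv ℝ (radialCutoff x r k) y e) := by
  filter_upwards [eventually_fderiv_radialCutoff_mul_eq_zero hr hrt fun _ => (1 : ℝ)] with k hk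
  filter_upwards [hv] with y hy
  simp_rw [← ujump_eq_ujump_zero]
  simp_rw [mul_one] at hk
  by_cases h1 : dist y x < r
  · rw [fderiv_apply_eq_zero_of_eqOn_ball (c := 1)
      (fun z hz => radialCutoff_eq_one (ball_subset_closedBall hz) k) h1]
    simp
  by_cases h2 : dist y x < t
  · rw [Set.indicator_of_mem (mem_ball.2 h2), hy (h2.le.trans htρ) (not_lt.1 h1)]
  · rw [show fderiv ℝ (radialCutoff x r k) y e = 0 from hk y (not_lt.1 h2) e]
    simp

end Gluing

section GluingIdentity

variable {n : ℕ} (b : OrthonormalBasis (Fin (n + 1)) ℝ (EuclideanSpace ℝ (Fin (n + 1))))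
  {Ω : Set (EuclideanSpace ℝ (Fin (n + 1)))} {x ν : EuclideanSpace ℝ (Fin (n + 1))}
  {v : EuclideanSpace ℝ (Fin (n + 1)) → ℝ} {σ : Measure (EuclideanSpace ℝ (Fin (n + 1)))}
  {f : EuclideanSpace ℝ (Fin (n + 1)) → EuclideanSpace ℝ (Fin (n + 1))} {r ρ : ℝ}

/-- The spin field equal to `v` in `closedBall x r` and to `u_{x,ν}` outside. -/
noncomputable def glue (v : EuclideanSpace ℝ (Fin d) → ℝ) (x ν : EuclideanSpace ℝ (Fin d)) (r : ℝ)
    (y : EuclideanSpace ℝ (Fin d)) : ℝ :=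
  (closedBall x r).indicator v y + (closedBall x r)ᶜ.indicator (ujump x ν) y

theorem glue_of_dist_le {v : EuclideanSpace ℝ (Fin d) → ℝ} {x ν y : EuclideanSpace ℝ (Fin d)}
    {r : ℝ}
    (h : dist y x ≤ r) : glue v x ν r y = v y := by
  simp [glue, h]

theorem glue_of_lt_dist {v : EuclideanSpace ℝ (Fin d) → ℝ} {x ν y : EuclideanSpace ℝ (Fin d)}
    {r : ℝ}
    (h : r < dist y x) : glue v x ν r y = ujump x ν y := by
  simp [glue, h]

theorem integrable_indicator_mul_of_isSpinRep (h : IsSpinRep Ω v σ f)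
    (hν : ‖ν‖ = 1) {t s : ℝ} (ht : 0 < t) (hts : t < s) (hsρ : s < ρ) (hρ : closedBall x ρ ⊆ Ω)
    (hv : ∀ᵐ y ∂volume, y ∈ closedBall x ρ → s ≤ dist y x → v y = ujump x ν y)
    {φ : EuclideanSpace ℝ (Fin (n + 1)) → ℝ} (hφ : Integrable φ) :
    Integrable fun y => (ball x t).indicator v y * φ y := by
  refine hφ.bdd_mul (c := 1)
    ((aestronglyMeasurable_indicator_iff measurableSet_ball).2
      (h.aestronglyMeasurable_ball hν ht hts hsρ hρ hv)) ?_
  filter_upwards [h.1] with y hy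
  by_cases hyt : y ∈ ball x t
  · rw [Set.indicator_of_mem hyt]
    rcases hy (hρ ((ball_subset_closedBall.trans
      (closedBall_subset_closedBall (hts.trans hsρ).le)) hyt)) with h' | h' <;> simp [h']
  · simp [Set.indicator_of_notMem hyt]

theorem IsSpinRep.integrableOn_mul_inner (h : IsSpinRep Ω v σ f)
    (hν : ‖ν‖ = 1) (hr : 0 < r) (hrρ : r < ρ) (hρ : closedBall x ρ ⊆ Ω)
    (hv : ∀ᵐ y ∂volume, y ∈ closedBall x ρ → r ≤ dist y x → v y = ujump x ν y)
    {ψ : EuclideanSpace ℝ (Fin (n + 1)) → ℝ} (hψ : Continuous ψ)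
    (hc : HasCompactSupport ψ) (e : EuclideanSpace ℝ (Fin (n + 1))) :
    IntegrableOn (fun y => ψ y * ⟪f y, e⟫) (closedBall x r) σ := by
  obtain ⟨B, hB⟩ := hc.exists_bound_of_continuous hψ
  refine IntegrableOn.of_bound (h.measure_lt_top_of_isCompact (isCompact_closedBall x r)
    ((closedBall_subset_closedBall hrρ.le).trans hρ))
    (hψ.aestronglyMeasurable.mul (h.aestronglyMeasurable_inner hν hr hrρ hρ hv e)) (B * ‖e‖) ?_
  filter_upwards [ae_restrict_of_ae (h.ae_abs_inner_le e)] with y hy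
  rw [norm_mul]
  exact mul_le_mul (hB y) hy (norm_nonneg _) ((norm_nonneg _).trans (hB y))

theorem IsSpinRep.tendsto_integral_radialCutoff_mul_inner (h : IsSpinRep Ω v σ f)
    (hν : ‖ν‖ = 1) (hr : 0 < r) (hrρ : r < ρ) (hρ : closedBall x ρ ⊆ Ω)
    (hv : ∀ᵐ y ∂volume, y ∈ closedBall x ρ → r ≤ dist y x → v y = ujump x ν y)
    (hσ : σ (sphere x r) = 0) {ψ : EuclideanSpace ℝ (Fin (n + 1)) → ℝ} (hψ : Continuous ψ)
    (hc : HasCompactSupport ψ) (e : EuclideanSpace ℝ (Fin (n + 1))) :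
    Tendsto (fun k => ∫ y, radialCutoff x r k y * ψ y * ⟪f y, e⟫ ∂σ) atTop
      (nhds (∫ y in ball x r, ψ y * ⟪f y, e⟫ ∂σ)) := by
  obtain ⟨t, hrt, htρ⟩ := exists_between hrρ
  have hsub : closedBall x r ⊆ closedBall x t := closedBall_subset_closedBall hrt.le
  have hint := h.integrableOn_mul_inner hν (hr.trans hrt) htρ hρ
    (hv.mono fun y hy h1 h2 => hy h1 (hrt.le.trans h2)) hψ hc e
  have hlim := tendsto_integral_radialCutoff_mul (x := x) hr.le hint
  rw [Measure.restrict_restrict isClosed_closedBall.measurableSet,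
    Set.inter_eq_self_of_subset_left hsub] at hlim
  have hball : (ball x r : Set _) =ᵐ[σ] closedBall x r := by
    rw [← ball_union_sphere]
    exact (union_ae_eq_left_of_ae_eq_empty (ae_eq_empty.2 hσ)).symm
  rw [Measure.restrict_congr_set hball]
  refine hlim.congr' ?_
  filter_upwards [eventually_radialCutoff_eq_zero (x := x) hr.le hrt] with k hk
  simp_rw [← mul_assoc]
  refine setIntegral_eq_integral_of_forall_compl_eq_zero fun y hy => ?_
  simp [hk y (not_le.1 hy).le]

theorem integral_glue_mul_fderiv (hΩ : IsOpen Ω) (h : IsSpinRep Ω v σ f) (hν : ‖ν‖ = 1)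
    (hr : 0 < r) (hrρ : r < ρ) (hρ : closedBall x ρ ⊆ Ω)
    (hv : ∀ᵐ y ∂volume, y ∈ closedBall x ρ → r ≤ dist y x → v y = ujump x ν y)
    (hσ : σ (sphere x r) = 0) {ψ : EuclideanSpace ℝ (Fin (n + 1)) → ℝ}
    (hψ : ContDiff ℝ (⊤ : ℕ∞) ψ) (hc : HasCompactSupport ψ) (hs : tsupport ψ ⊆ Ω)
    (e : EuclideanSpace ℝ (Fin (n + 1))) :
    ∫ y, glue v x (b 0) r y * fderiv ℝ ψ y e =
      -2 * ((∫ y in ball x r, ψ y * ⟪f y, e⟫ ∂σ) +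
        ∫ y in (closedBall x r)ᶜ, ψ y * ⟪b 0, e⟫ ∂(hyperplaneMeasure b x).restrict Ω) +
      ∫ ω : sphere (0 : EuclideanSpace ℝ (Fin (n + 1))) 1,
        (ujump 0 ν ω - ujump 0 (b 0) ω) * ⟪(ω : EuclideanSpace ℝ (Fin (n + 1))), e⟫ *
          (r ^ n * ψ (x + r • ω.1))
        ∂(volume : Measure (EuclideanSpace ℝ (Fin (n + 1)))).toSphere := by
  obtain ⟨t, hrt, htρ⟩ := exists_between hrρ
  obtain ⟨s, hts, hsρ⟩ := exists_between htρ
  have ht : 0 < t := hr.trans hrt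
  have hψ1 : ContDiff ℝ 1 ψ := hψ.of_le (by simp)
  have hvs : ∀ᵐ y ∂volume, y ∈ closedBall x ρ → s ≤ dist y x → v y = ujump x ν y :=
    hv.mono fun y hy h1 h2 => hy h1 ((hrt.trans hts).le.trans h2)
  have hη := fun k => contDiff_radialCutoff (x := x) (r := r) k
  have hη1 : ∀ k, ContDiff ℝ (⊤ : ℕ∞) fun y => 1 - radialCutoff x r k y :=
    fun k => contDiff_const.sub (hη k)
  have hD := integrable_fderiv_apply_const hψ1 hc e
  have hvD := integrable_indicator_mul_of_isSpinRep h hν ht hts hsρ hρ hvs hD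
  have huD := integrable_ujump_mul x (b 0) hD
  have hψD : ∀ k, Integrable fun y => ψ y * fderiv ℝ (radialCutoff x r k) y e := fun k =>
    (hψ.continuous.mul (continuous_fderiv_apply_const ((hη k).of_le (by simp))
      e)).integrable_of_hasCompactSupport hc.mul_right
  have hvψ := fun k => integrable_indicator_mul_of_isSpinRep h hν ht hts hsρ hρ hvs (hψD k)
  have huψ := fun k => integrable_ujump_mul x (b 0) (hψD k)
  -- the identities for the two fields, tested with `η_k ψ` and `(1 - η_k) ψ`
  have hleft : ∀ᶠ k : ℕ in atTop,
      (∫ y, radialCutoff x r k y * ((ball x t).indicator v y * fderiv ℝ ψ y e)) +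
        ∫ y, (ball x t).indicator v y * (ψ y * fderiv ℝ (radialCutoff x r k) y e) =
      -2 * ∫ y, radialCutoff x r k y * ψ y * ⟪f y, e⟫ ∂σ := by
    filter_upwards [eventually_fderiv_radialCutoff_mul_eq_zero (x := x) hr.le hrt ψ] with k hk
    rw [← h.2.2.2.2 _ ((hη k).mul hψ) hc.mul_left ((tsupport_mul_subset_right).trans hs) e,
      ← integral_add (integrable_radialCutoff_mul hvD k) (hvψ k)]
    refine integral_congr_ae (Eventually.of_forall fun y => ?_)
    have h1 := fderiv_mul_apply_eq (hη k) hψ y e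
    by_cases hy : y ∈ ball x t
    · simp only [Set.indicator_of_mem hy]
      rw [h1]; ring
    · have h2 := hk y (not_lt.1 hy) e
      simp only [Set.indicator_of_notMem hy]
      rw [h2]; ring
  have hright : ∀ k : ℕ,
      (∫ y, (1 - radialCutoff x r k y) * (ujump x (b 0) y * fderiv ℝ ψ y e)) -
        ∫ y, ujump x (b 0) y * (ψ y * fderiv ℝ (radialCutoff x r k) y e) =
      -2 * ∫ y, (1 - radialCutoff x r k y) * (ψ y * ⟪b 0, e⟫)
        ∂(hyperplaneMeasure b x).restrict Ω := fun k => by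
    simp_rw [← mul_assoc _ (ψ _) ⟪b 0, e⟫]
    have hint : Integrable fun y =>
        (1 - radialCutoff x r k y) * (ujump x (b 0) y * fderiv ℝ ψ y e) := by
      refine (huD.sub (integrable_radialCutoff_mul (x := x) (r := r) huD k)).congr
        (Eventually.of_forall fun y => ?_)
      simp only [Pi.sub_apply]; ring
    rw [← (isSpinRep_ujump b hΩ x).2.2.2.2 _ ((hη1 k).mul hψ) hc.mul_left
      ((tsupport_mul_subset_right).trans hs) e, ← integral_sub hint (huψ k)]
    refine integral_congr_ae (Eventually.of_forall fun y => ?_)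
    have h1 := fderiv_mul_apply_eq (hη1 k) hψ y e
    beta_reduce
    rw [h1, fderiv_const_sub]
    simp only [neg_apply]
    ring
  have hsum : ∀ᶠ k : ℕ in atTop,
      (∫ y, radialCutoff x r k y * ((ball x t).indicator v y * fderiv ℝ ψ y e)) +
      (∫ y, (1 - radialCutoff x r k y) * (ujump x (b 0) y * fderiv ℝ ψ y e)) +
      (∫ y, (ujump 0 ν (y - x) - ujump 0 (b 0) (y - x)) *
        (ψ y * fderiv ℝ (radialCutoff x r k) y e)) =
      -2 * ((∫ y, radialCutoff x r k y * ψ y * ⟪f y, e⟫ ∂σ) +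
        ∫ y, (1 - radialCutoff x r k y) * (ψ y * ⟪b 0, e⟫)
          ∂(hyperplaneMeasure b x).restrict Ω) := by
    filter_upwards [hleft, eventually_ae_jump_eq (ν₂ := b 0) hr.le hrt htρ.le hv ψ e] with k hk1 hk2
    rw [mul_add, ← hk1, ← hright k, ← integral_congr_ae hk2]
    simp_rw [sub_mul _ _ (ψ _ * _)]
    rw [integral_sub (hvψ k) (huψ k)]
    ring
  have hL := ((tendsto_integral_radialCutoff_mul (x := x) hr.le hvD).add
    (tendsto_integral_one_sub_radialCutoff_mul (x := x) hr.le huD)).add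
    (tendsto_integral_mul_fderiv_radialCutoff (x := x) (r := r)
      (A := fun y => ujump 0 ν y - ujump 0 (b 0) y)
      ((measurable_ujump 0 ν).sub (measurable_ujump 0 (b 0))) (M := 2)
      (fun y => (abs_sub _ _).trans (by rw [abs_ujump, abs_ujump]; norm_num))
      (fun t ht y => by rw [ujump_zero_smul _ _ ht, ujump_zero_smul _ _ ht]) hψ1 hc hr e)
  have hψint : Integrable (fun y => ψ y * ⟪b 0, e⟫) ((hyperplaneMeasure b x).restrict Ω) :=
    (isSpinRep_ujump b hΩ x).integrable_mul_inner hψ.continuous hc hs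
      (hψ.continuous.mul continuous_const).aestronglyMeasurable
  have hR := ((h.tendsto_integral_radialCutoff_mul_inner hν hr hrρ hρ hv hσ hψ.continuous hc e).add
    (tendsto_integral_one_sub_radialCutoff_mul (x := x) hr.le hψint)).const_mul (-2)
  have key := tendsto_nhds_unique (hL.congr' hsum) hR
  have hglue : ∫ y, glue v x (b 0) r y * fderiv ℝ ψ y e =
      (∫ y in closedBall x r, (ball x t).indicator v y * fderiv ℝ ψ y e) +
        ∫ y in (closedBall x r)ᶜ, ujump x (b 0) y * fderiv ℝ ψ y e := by
    have hm : MeasurableSet (closedBall x r) := isClosed_closedBall.measurableSet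
    rw [← integral_indicator hm, ← integral_indicator hm.compl,
      ← integral_add (hvD.indicator hm) (huD.indicator hm.compl)]
    refine integral_congr_ae (Eventually.of_forall fun y => ?_)
    by_cases hy : y ∈ closedBall x r
    · simp [glue_of_dist_le (mem_closedBall.1 hy), hy, (mem_closedBall.1 hy).trans_lt hrt]
    · simp [glue_of_lt_dist (not_le.1 fun h => hy (mem_closedBall.2 h)), hy]
  rw [hglue, ← key]
  simp_rw [mul_neg]
  rw [integral_neg]
  ring

end GluingIdentity

section GluedRep

variable {n : ℕ} (b : OrthonormalBasis (Fin (n + 1)) ℝ (EuclideanSpace ℝ (Fin (n + 1))))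
  {Ω : Set (EuclideanSpace ℝ (Fin (n + 1)))} {x ν : EuclideanSpace ℝ (Fin (n + 1))}
  {v : EuclideanSpace ℝ (Fin (n + 1)) → ℝ} {σ : Measure (EuclideanSpace ℝ (Fin (n + 1)))}
  {f : EuclideanSpace ℝ (Fin (n + 1)) → EuclideanSpace ℝ (Fin (n + 1))} {r ρ : ℝ}

/-- The directions in which the half-space fields with normals `ν₁` and `ν₂` differ. -/
def jumpDirections (ν₁ ν₂ : EuclideanSpace ℝ (Fin d)) :
    Set (sphere (0 : EuclideanSpace ℝ (Fin d)) 1) :=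
  {ω | ujump 0 ν₁ ω ≠ ujump 0 ν₂ ω}

theorem measurableSet_jumpDirections (ν₁ ν₂ : EuclideanSpace ℝ (Fin d)) :
    MeasurableSet (jumpDirections ν₁ ν₂) :=
  (measurableSet_eq_fun ((measurable_ujump 0 ν₁).comp measurable_subtype_coe)
    ((measurable_ujump 0 ν₂).comp measurable_subtype_coe)).compl

/-- The surface measure on the part of `sphere x r` where the traces of `u_{x,ν₁}` and `u_{x,ν₂}`
differ. -/
noncomputable def jumpSphereMeasure (x ν₁ ν₂ : EuclideanSpace ℝ (Fin d)) (r : ℝ) :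
    Measure (EuclideanSpace ℝ (Fin d)) :=
  ENNReal.ofReal (r ^ (d - 1)) •
    ((volume : Measure (EuclideanSpace ℝ (Fin d))).toSphere.restrict (jumpDirections ν₁ ν₂)).map
      fun ω : sphere (0 : EuclideanSpace ℝ (Fin d)) 1 => x + r • ω.1

theorem measurableEmbedding_sphere (x : EuclideanSpace ℝ (Fin d)) (hr : r ≠ 0) :
    MeasurableEmbedding fun ω : sphere (0 : EuclideanSpace ℝ (Fin d)) 1 => x + r • ω.1 := by
  have hc : Continuous fun ω : sphere (0 : EuclideanSpace ℝ (Fin d)) 1 => x + r • ω.1 := by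
    fun_prop
  refine (hc.isClosedEmbedding fun ω₁ ω₂ h => ?_).measurableEmbedding
  exact Subtype.ext (smul_right_injective _ hr (add_left_cancel h))

theorem ae_jumpSphereMeasure {ν₁ ν₂ : EuclideanSpace ℝ (Fin d)} {x : EuclideanSpace ℝ (Fin d)}
    (hr : 0 < r) {p : EuclideanSpace ℝ (Fin d) → Prop}
    (h : ∀ ω : sphere (0 : EuclideanSpace ℝ (Fin d)) 1, ω ∈ jumpDirections ν₁ ν₂ →
      p (x + r • ω.1)) : ∀ᵐ y ∂jumpSphereMeasure x ν₁ ν₂ r, p y := by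
  refine Measure.ae_smul_measure ?_ _
  rw [(measurableEmbedding_sphere x hr.ne').ae_map_iff]
  exact (ae_restrict_iff' (measurableSet_jumpDirections ν₁ ν₂)).2 (Eventually.of_forall h)

theorem integral_jumpSphereMeasure {ν₁ ν₂ : EuclideanSpace ℝ (Fin d)}
    {x : EuclideanSpace ℝ (Fin d)} (hr : 0 < r) (φ : EuclideanSpace ℝ (Fin d) → ℝ) :
    ∫ y, φ y ∂jumpSphereMeasure x ν₁ ν₂ r =
      r ^ (d - 1) * ∫ ω in jumpDirections ν₁ ν₂, φ (x + r • ω.1)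
        ∂(volume : Measure (EuclideanSpace ℝ (Fin d))).toSphere := by
  rw [jumpSphereMeasure, integral_smul_measure,
    (measurableEmbedding_sphere x hr.ne').integral_map, ENNReal.toReal_ofReal (by positivity),
    smul_eq_mul]

instance (x ν₁ ν₂ : EuclideanSpace ℝ (Fin d)) :
    IsFiniteMeasure (jumpSphereMeasure x ν₁ ν₂ r) := by
  rw [jumpSphereMeasure]
  exact Measure.smul_finite _ ENNReal.ofReal_ne_top

/-- The interface measure of `glue v x (b 0) r`. -/
noncomputable def glueMeasure (Ω : Set (EuclideanSpace ℝ (Fin (n + 1))))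
    (σ : Measure (EuclideanSpace ℝ (Fin (n + 1)))) (x ν : EuclideanSpace ℝ (Fin (n + 1))) (r : ℝ) :
    Measure (EuclideanSpace ℝ (Fin (n + 1))) :=
  σ.restrict (ball x r) + ((hyperplaneMeasure b x).restrict Ω).restrict (closedBall x r)ᶜ +
    jumpSphereMeasure x ν (b 0) r

/-- The interface normal of `glue v x ν₂ r`, when `v` agrees with `u_{x,ν₁}` near `sphere x r`. -/
noncomputable def glueNormal (f : EuclideanSpace ℝ (Fin d) → EuclideanSpace ℝ (Fin d))
    (x ν₁ ν₂ : EuclideanSpace ℝ (Fin d)) (r : ℝ) (y : EuclideanSpace ℝ (Fin d)) :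
    EuclideanSpace ℝ (Fin d) :=
  if dist y x < r then f y else if r < dist y x then ν₂ else
    (-((ujump x ν₁ y - ujump x ν₂ y) / 2) * r⁻¹) • (y - x)

theorem glueNormal_of_mem_ball {f : EuclideanSpace ℝ (Fin d) → EuclideanSpace ℝ (Fin d)}
    {x ν₁ ν₂ y : EuclideanSpace ℝ (Fin d)} (h : y ∈ ball x r) : glueNormal f x ν₁ ν₂ r y = f y :=
  if_pos h

theorem glueNormal_of_notMem_closedBall {f : EuclideanSpace ℝ (Fin d) → EuclideanSpace ℝ (Fin d)}
    {x ν₁ ν₂ y : EuclideanSpace ℝ (Fin d)} (h : y ∈ (closedBall x r)ᶜ) :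
    glueNormal f x ν₁ ν₂ r y = ν₂ := by
  have h' : r < dist y x := not_le.1 h
  rw [glueNormal, if_neg h'.le.not_gt, if_pos h']

theorem glueNormal_of_mem_sphere {f : EuclideanSpace ℝ (Fin d) → EuclideanSpace ℝ (Fin d)}
    {x ν₁ ν₂ : EuclideanSpace ℝ (Fin d)} (hr : 0 < r)
    (ω : sphere (0 : EuclideanSpace ℝ (Fin d)) 1) :
    glueNormal f x ν₁ ν₂ r (x + r • ω.1) = (-((ujump 0 ν₁ ω - ujump 0 ν₂ ω) / 2)) • ω.1 := by
  have h' : dist (x + r • ω.1) x = r := by simp [dist_eq_norm, norm_smul, abs_of_pos hr]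
  rw [glueNormal, h', if_neg (lt_irrefl r), if_neg (lt_irrefl r), ujump_eq_ujump_zero x ν₁,
    ujump_eq_ujump_zero x ν₂, add_sub_cancel_left, ujump_zero_smul _ _ hr, ujump_zero_smul _ _ hr,
    smul_smul, mul_assoc, inv_mul_cancel₀ hr.ne', mul_one]

theorem norm_glueNormal_of_mem_jumpDirections
    {f : EuclideanSpace ℝ (Fin d) → EuclideanSpace ℝ (Fin d)}
    {x ν₁ ν₂ : EuclideanSpace ℝ (Fin d)} (hr : 0 < r) {ω : sphere (0 : EuclideanSpace ℝ (Fin d)) 1}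
    (hω : ω ∈ jumpDirections ν₁ ν₂) : ‖glueNormal f x ν₁ ν₂ r (x + r • ω.1)‖ = 1 := by
  rw [glueNormal_of_mem_sphere hr, norm_smul]
  have : ujump 0 ν₁ ω.1 ≠ ujump 0 ν₂ ω.1 := hω
  rcases ujump_eq_or 0 ν₁ ω.1 with h1 | h1 <;> rcases ujump_eq_or 0 ν₂ ω.1 with h2 | h2 <;>
    first
      | exact absurd (h1.trans h2.symm) this
      | norm_num [h1, h2]

theorem mul_inner_glueNormal {f : EuclideanSpace ℝ (Fin d) → EuclideanSpace ℝ (Fin d)}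
    {x ν₁ ν₂ : EuclideanSpace ℝ (Fin d)} (hr : 0 < r) (ψ : EuclideanSpace ℝ (Fin d) → ℝ)
    (e : EuclideanSpace ℝ (Fin d)) (ω : sphere (0 : EuclideanSpace ℝ (Fin d)) 1) :
    ψ (x + r • ω.1) * ⟪glueNormal f x ν₁ ν₂ r (x + r • ω.1), e⟫ =
      -2⁻¹ * ((ujump 0 ν₁ ω - ujump 0 ν₂ ω) * ⟪ω.1, e⟫ * ψ (x + r • ω.1)) := by
  rw [glueNormal_of_mem_sphere hr, real_inner_smul_left]
  ring

theorem integrable_mul_inner_glueNormal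
    {f : EuclideanSpace ℝ (Fin d) → EuclideanSpace ℝ (Fin d)}
    {x ν₁ ν₂ : EuclideanSpace ℝ (Fin d)} (hr : 0 < r) {ψ : EuclideanSpace ℝ (Fin d) → ℝ}
    (hψ : Continuous ψ) (hc : HasCompactSupport ψ) (e : EuclideanSpace ℝ (Fin d)) :
    Integrable (fun y => ψ y * ⟪glueNormal f x ν₁ ν₂ r y, e⟫) (jumpSphereMeasure x ν₁ ν₂ r) := by
  refine Integrable.smul_measure ?_ ENNReal.ofReal_ne_top
  rw [(measurableEmbedding_sphere x hr.ne').integrable_map_iff]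
  obtain ⟨B, hB⟩ := hc.exists_bound_of_continuous hψ
  refine Integrable.congr (f := fun ω : sphere (0 : EuclideanSpace ℝ (Fin d)) 1 =>
    -2⁻¹ * ((ujump 0 ν₁ ω - ujump 0 ν₂ ω) * ⟪ω.1, e⟫ * ψ (x + r • ω.1)))
    (Integrable.const_mul ?_ _) (Eventually.of_forall fun ω => (mul_inner_glueNormal hr ψ e ω).symm)
  have hm : Measurable fun ω : sphere (0 : EuclideanSpace ℝ (Fin d)) 1 =>
      ujump 0 ν₁ ω - ujump 0 ν₂ ω :=
    ((measurable_ujump 0 ν₁).sub (measurable_ujump 0 ν₂)).comp measurable_subtype_coe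
  have hin : Continuous fun ω : sphere (0 : EuclideanSpace ℝ (Fin d)) 1 => ⟪ω.1, e⟫ := by fun_prop
  have hψ' : Continuous fun ω : sphere (0 : EuclideanSpace ℝ (Fin d)) 1 => ψ (x + r • ω.1) := by
    fun_prop
  refine Integrable.of_bound ((hm.mul hin.measurable).mul hψ'.measurable).aestronglyMeasurable
    (2 * ‖e‖ * B) (Eventually.of_forall fun ω => ?_)
  have h1 : ‖ujump 0 ν₁ ω.1 - ujump 0 ν₂ ω.1‖ ≤ 2 :=
    (abs_sub _ _).trans (by rw [abs_ujump, abs_ujump]; norm_num)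
  have h2 : ‖⟪ω.1, e⟫‖ ≤ ‖e‖ := by simpa using abs_real_inner_le_norm ω.1 e
  rw [norm_mul, norm_mul]
  gcongr
  exact hB _

theorem integral_mul_inner_glueNormal
    {f : EuclideanSpace ℝ (Fin d) → EuclideanSpace ℝ (Fin d)}
    {x ν₁ ν₂ : EuclideanSpace ℝ (Fin d)} (hr : 0 < r) (ψ : EuclideanSpace ℝ (Fin d) → ℝ)
    (e : EuclideanSpace ℝ (Fin d)) :
    ∫ y, ψ y * ⟪glueNormal f x ν₁ ν₂ r y, e⟫ ∂jumpSphereMeasure x ν₁ ν₂ r =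
      -2⁻¹ * ∫ ω : sphere (0 : EuclideanSpace ℝ (Fin d)) 1,
        (ujump 0 ν₁ ω - ujump 0 ν₂ ω) * ⟪ω.1, e⟫ * (r ^ (d - 1) * ψ (x + r • ω.1))
        ∂(volume : Measure (EuclideanSpace ℝ (Fin d))).toSphere := by
  rw [integral_jumpSphereMeasure hr, ← integral_const_mul, ← integral_const_mul]
  rw [setIntegral_eq_integral_of_forall_compl_eq_zero fun ω hω => ?_]
  · refine integral_congr_ae (Eventually.of_forall fun ω => ?_)
    beta_reduce
    rw [mul_inner_glueNormal hr]
    ring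
  · rw [mul_inner_glueNormal hr, show ujump 0 ν₁ ω.1 = ujump 0 ν₂ ω.1 from not_not.1 hω]
    ring

theorem isSpinRep_glue (hΩ : IsOpen Ω) (h : IsSpinRep Ω v σ f) (hν : ‖ν‖ = 1)
    (hr : 0 < r) (hrρ : r < ρ) (hρ : closedBall x ρ ⊆ Ω)
    (hv : ∀ᵐ y ∂volume, y ∈ closedBall x ρ → r ≤ dist y x → v y = ujump x ν y)
    (hσ : σ (sphere x r) = 0) :
    IsSpinRep Ω (glue v x (b 0) r) (glueMeasure b Ω σ x ν r) (glueNormal f x ν (b 0) r) := by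
  have hu := isSpinRep_ujump b hΩ x
  refine ⟨?_, fun y hy => ?_, ?_, ?_, fun ψ hψ hc hs e => ?_⟩
  · filter_upwards [h.1] with y hy hyΩ
    rcases le_or_gt (dist y x) r with h1 | h1
    · rw [glue_of_dist_le h1]; exact hy hyΩ
    · rw [glue_of_lt_dist h1]; exact ujump_eq_or _ _ _
  · obtain ⟨s₁, hs₁, h₁⟩ := h.2.1 y hy
    obtain ⟨s₂, hs₂, h₂⟩ := hu.2.1 y hy
    refine ⟨s₁ ∩ s₂, inter_mem hs₁ hs₂, ?_⟩
    simp only [glueMeasure, Measure.add_apply]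
    refine ENNReal.add_lt_top.2 ⟨ENNReal.add_lt_top.2 ⟨?_, ?_⟩, measure_lt_top _ _⟩
    · exact ((Measure.restrict_apply_le _ _).trans (measure_mono Set.inter_subset_left)).trans_lt h₁
    · exact ((Measure.restrict_apply_le _ _).trans
        (measure_mono Set.inter_subset_right)).trans_lt h₂
  · simp only [glueMeasure, Measure.add_apply, add_eq_zero]
    refine ⟨⟨?_, ?_⟩, ?_⟩
    · exact le_antisymm ((Measure.restrict_apply_le _ _).trans h.2.2.1.le) zero_le
    · exact le_antisymm ((Measure.restrict_apply_le _ _).trans hu.2.2.1.le) zero_le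
    · refine measure_eq_zero_iff_ae_notMem.2 (ae_jumpSphereMeasure hr fun ω _ => ?_)
      refine not_not.2 (hρ ?_)
      simpa [dist_eq_norm, norm_smul, abs_of_pos hr] using hrρ.le
  · simp only [glueMeasure, ae_add_measure_iff]
    refine ⟨⟨?_, ?_⟩, ?_⟩
    · rw [ae_restrict_iff' measurableSet_ball]
      filter_upwards [h.2.2.2.1] with y hy hyb
      rw [glueNormal_of_mem_ball hyb, hy]
    · rw [ae_restrict_iff' isClosed_closedBall.measurableSet.compl]
      refine Eventually.of_forall fun y hy => ?_
      rw [glueNormal_of_notMem_closedBall hy]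
      exact b.orthonormal.1 0
    · exact ae_jumpSphereMeasure hr fun ω hω => norm_glueNormal_of_mem_jumpDirections hr hω
  · rw [integral_glue_mul_fderiv b hΩ h hν hr hrρ hρ hv hσ hψ hc hs e, glueMeasure]
    have h1 : ∀ y ∈ ball x r, ψ y * ⟪f y, e⟫ = ψ y * ⟪glueNormal f x ν (b 0) r y, e⟫ :=
      fun y hy => by rw [glueNormal_of_mem_ball hy]
    have h2 : ∀ y ∈ (closedBall x r)ᶜ,
        ψ y * ⟪b 0, e⟫ = ψ y * ⟪glueNormal f x ν (b 0) r y, e⟫ :=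
      fun y hy => by rw [glueNormal_of_notMem_closedBall hy]
    have hi1 : IntegrableOn (fun y => ψ y * ⟪f y, e⟫) (ball x r) σ :=
      (h.integrableOn_mul_inner hν hr hrρ hρ hv hψ.continuous hc e).mono_set ball_subset_closedBall
    have hi2 : IntegrableOn (fun y => ψ y * ⟪b 0, e⟫) (closedBall x r)ᶜ
        ((hyperplaneMeasure b x).restrict Ω) :=
      (hu.integrable_mul_inner hψ.continuous hc hs
        (hψ.continuous.mul continuous_const).aestronglyMeasurable).integrableOn
    have hi12 := (hi1.congr_fun h1 measurableSet_ball).integrable.add_measure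
      (hi2.congr_fun h2 isClosed_closedBall.measurableSet.compl).integrable
    rw [integral_add_measure hi12 (integrable_mul_inner_glueNormal hr hψ.continuous hc e),
      integral_add_measure (hi1.congr_fun h1 measurableSet_ball).integrable
      (hi2.congr_fun h2 isClosed_closedBall.measurableSet.compl).integrable,
      ← setIntegral_congr_fun measurableSet_ball h1,
      ← setIntegral_congr_fun isClosed_closedBall.measurableSet.compl h2,
      integral_mul_inner_glueNormal hr]
    simp only [Nat.add_sub_cancel]
    ring

end GluedRep

section Energy

variable {n : ℕ} {x : EuclideanSpace ℝ (Fin d)} {ρ : ℝ}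

theorem exists_ball_of_aestronglyMeasurable_imp (σ : Measure (EuclideanSpace ℝ (Fin d)))
    (F : EuclideanSpace ℝ (Fin d) → ℝ) :
    ∃ s < ρ, ∀ r, s ≤ r → AEStronglyMeasurable F (σ.restrict (ball x r)) →
      AEStronglyMeasurable F (σ.restrict (ball x ρ)) := by
  by_contra! hcon
  obtain ⟨u, -, hu, hlim⟩ := exists_seq_strictMono_tendsto ρ
  obtain ⟨r, -, -, hr⟩ := hcon (ρ - 1) (by linarith)
  refine hr ?_
  have hU : ball x ρ ⊆ ⋃ k, ball x (u k) := fun y hy => by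
    obtain ⟨k, hk⟩ := (hlim.eventually (lt_mem_nhds (mem_ball.1 hy))).exists
    exact Set.mem_iUnion.2 ⟨k, hk⟩
  refine AEStronglyMeasurable.mono_set hU (aestronglyMeasurable_iUnion_iff.2 fun k => ?_)
  obtain ⟨r', hr', hm, -⟩ := hcon (u k) (hu k)
  exact hm.mono_set (ball_subset_ball hr')

theorem exists_measure_shell_le (μ : Measure (EuclideanSpace ℝ (Fin d))) (hμ : μ (ball x ρ) ≠ ⊤)
    {ε : ENNReal} (hε : 0 < ε) :
    ∃ s < ρ, ∀ r, s ≤ r → μ (ball x ρ \ closedBall x r) ≤ ε := by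
  obtain ⟨u, hmono, hu, hlim⟩ := exists_seq_strictMono_tendsto ρ
  have h := tendsto_measure_iInter_atTop (μ := μ) (s := fun k => ball x ρ \ closedBall x (u k))
    (fun k => (measurableSet_ball.diff measurableSet_closedBall).nullMeasurableSet)
    (fun i j hij => Set.sdiff_subset_sdiff_right
      (closedBall_subset_closedBall (hmono.monotone hij)))
    ⟨0, measure_ne_top_of_subset Set.sdiff_subset hμ⟩
  have hI : ⋂ k, ball x ρ \ closedBall x (u k) = ∅ := by
    refine Set.eq_empty_of_forall_notMem fun y hy => ?_
    rw [Set.mem_iInter] at hy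
    obtain ⟨k, hk⟩ := (hlim.eventually (lt_mem_nhds (mem_ball.1 (hy 0).1))).exists
    exact (hy k).2 (mem_closedBall.2 hk.le)
  rw [hI, measure_empty] at h
  obtain ⟨k, hk⟩ := (h.eventually (gt_mem_nhds hε)).exists
  exact ⟨u k, hu k, fun r hr =>
    (measure_mono (Set.sdiff_subset_sdiff_right (closedBall_subset_closedBall hr))).trans hk.le⟩

theorem exists_sphere_measure_eq_zero {σ : Measure (EuclideanSpace ℝ (Fin d))}
    (hσ : σ (closedBall x ρ) < ⊤) {s : ℝ} (hs : s < ρ) :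
    ∃ r, s < r ∧ r < ρ ∧ σ (sphere x r) = 0 := by
  have : IsFiniteMeasure (σ.restrict (closedBall x ρ)) := ⟨by simpa using hσ⟩
  have hcount := Measure.countable_meas_level_set_pos (μ := σ.restrict (closedBall x ρ))
    (g := fun y => dist y x) (by fun_prop)
  obtain ⟨r, hr, hr'⟩ := (hcount.dense_compl ℝ).exists_mem_open isOpen_Ioo (Set.nonempty_Ioo.2 hs)
  refine ⟨r, hr'.1, hr'.2, ?_⟩
  have h0 : (σ.restrict (closedBall x ρ)) (sphere x r) = 0 :=
    le_antisymm (not_lt.1 hr) zero_le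
  rwa [Measure.restrict_eq_self _ (sphere_subset_closedBall.trans
    (closedBall_subset_closedBall hr'.2.le))] at h0

theorem jumpSphereMeasure_univ (x ν₁ ν₂ : EuclideanSpace ℝ (Fin d)) {r : ℝ} (hr : 0 < r) :
    jumpSphereMeasure x ν₁ ν₂ r Set.univ = ENNReal.ofReal (r ^ (d - 1)) *
      (volume : Measure (EuclideanSpace ℝ (Fin d))).toSphere (jumpDirections ν₁ ν₂) := by
  simp [jumpSphereMeasure, (measurableEmbedding_sphere x hr.ne').map_apply]

variable {Ω : Set (EuclideanSpace ℝ (Fin d))} {C : ℝ}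
  {g : EuclideanSpace ℝ (Fin d) → EuclideanSpace ℝ (Fin d) → ℝ}

theorem surfE_nonneg (hC : 1 < C) (hg : ∀ x ∈ Ω, ∀ ν, ‖ν‖ / C ≤ g x ν ∧ g x ν ≤ C * ‖ν‖)
    (hρ : closedBall x ρ ⊆ Ω) (σ : Measure (EuclideanSpace ℝ (Fin d)))
    (f : EuclideanSpace ℝ (Fin d) → EuclideanSpace ℝ (Fin d)) : 0 ≤ surfE g σ f (ball x ρ) :=
  setIntegral_nonneg measurableSet_ball fun y hy =>
    (div_nonneg (norm_nonneg _) (by linarith)).trans (hg y (hρ (ball_subset_closedBall hy)) _).1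

theorem setIntegral_le_of_ae_norm_eq_one (hC : 1 < C)
    (hg : ∀ x ∈ Ω, ∀ ν, ‖ν‖ / C ≤ g x ν ∧ g x ν ≤ C * ‖ν‖)
    (hρ : closedBall x ρ ⊆ Ω) {μ : Measure (EuclideanSpace ℝ (Fin d))}
    {f : EuclideanSpace ℝ (Fin d) → EuclideanSpace ℝ (Fin d)} (hf : ∀ᵐ y ∂μ, ‖f y‖ = 1)
    (hμ : μ (ball x ρ) < ⊤) :
    ∫ y in ball x ρ, g y (f y) ∂μ ≤ C * (μ (ball x ρ)).toReal := by
  rw [← measureReal_def]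
  refine (Real.le_norm_self _).trans (norm_setIntegral_le_of_norm_le_const_ae' hμ ?_)
  filter_upwards [hf] with y hy hyb
  have h := hg y (hρ (ball_subset_closedBall hyb)) (f y)
  rw [hy, mul_one] at h
  rw [Real.norm_of_nonneg (le_trans (by positivity) h.1)]
  exact h.2

end Energy

section Competitor

variable {n : ℕ} (b : OrthonormalBasis (Fin (n + 1)) ℝ (EuclideanSpace ℝ (Fin (n + 1))))
  {Ω : Set (EuclideanSpace ℝ (Fin (n + 1)))} {x ν : EuclideanSpace ℝ (Fin (n + 1))} {C : ℝ}
  {g : EuclideanSpace ℝ (Fin (n + 1)) → EuclideanSpace ℝ (Fin (n + 1)) → ℝ}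
  {v : EuclideanSpace ℝ (Fin (n + 1)) → ℝ} {σ : Measure (EuclideanSpace ℝ (Fin (n + 1)))}
  {f : EuclideanSpace ℝ (Fin (n + 1)) → EuclideanSpace ℝ (Fin (n + 1))} {r ρ : ℝ}

theorem surfE_glue_le (hC : 1 < C) (hg : ∀ x ∈ Ω, ∀ ν, ‖ν‖ / C ≤ g x ν ∧ g x ν ≤ C * ‖ν‖)
    (h : IsSpinRep Ω v σ f) (hr : 0 < r) (hrρ : r < ρ) (hρ : closedBall x ρ ⊆ Ω)
    (hm : AEStronglyMeasurable (fun y => g y (f y)) (σ.restrict (ball x r)) →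
      AEStronglyMeasurable (fun y => g y (f y)) (σ.restrict (ball x ρ))) :
    surfE g (glueMeasure b Ω σ x ν r) (glueNormal f x ν (b 0) r) (ball x ρ) ≤
      surfE g σ f (ball x ρ) + C * (hyperplaneMeasure b x (ball x ρ \ closedBall x r)).toReal +
      C * (r ^ n * ((volume : Measure (EuclideanSpace ℝ (Fin (n + 1)))).toSphere
        (jumpDirections ν (b 0))).toReal) := by
  have hC0 : 0 < C := by linarith
  have hE := surfE_nonneg hC hg hρ σ f
  by_cases hi : IntegrableOn (fun y => g y (glueNormal f x ν (b 0) r y)) (ball x ρ)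
    (glueMeasure b Ω σ x ν r)
  swap
  · rw [surfE, integral_undef hi]
    positivity
  have hsub : ball x r ⊆ ball x ρ := ball_subset_ball hrρ.le
  rw [IntegrableOn, glueMeasure, Measure.restrict_add, Measure.restrict_add] at hi
  have hi3 := hi.right_of_add_measure
  have hi1 := hi.left_of_add_measure.left_of_add_measure
  have hi2 := hi.left_of_add_measure.right_of_add_measure
  rw [surfE, glueMeasure, Measure.restrict_add, Measure.restrict_add,
    integral_add_measure hi.left_of_add_measure hi3, integral_add_measure hi1 hi2]
  have hfin : σ (ball x ρ) < ⊤ := (measure_mono ball_subset_closedBall).trans_lt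
    (h.measure_lt_top_of_isCompact (isCompact_closedBall x ρ) hρ)
  have hgF : ∀ᵐ y ∂σ.restrict (ball x ρ), ‖g y (f y)‖ ≤ C := by
    rw [ae_restrict_iff' measurableSet_ball]
    filter_upwards [h.2.2.2.1] with y hy hyb
    have h := hg y (hρ (ball_subset_closedBall hyb)) (f y)
    rw [hy, mul_one] at h
    rw [Real.norm_of_nonneg (le_trans (by positivity) h.1)]
    exact h.2
  refine add_le_add (add_le_add ?_ ?_) ?_
  · rw [Measure.restrict_restrict measurableSet_ball, Set.inter_eq_self_of_subset_right hsub]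
      at hi1 ⊢
    have heq : ∀ y ∈ ball x r, g y (glueNormal f x ν (b 0) r y) = g y (f y) :=
      fun y hy => by rw [glueNormal_of_mem_ball hy]
    rw [setIntegral_congr_fun measurableSet_ball heq]
    refine setIntegral_mono_set (IntegrableOn.of_bound hfin (hm ?_) C hgF) ?_
      (Eventually.of_forall hsub)
    · exact ((integrableOn_congr_fun heq measurableSet_ball).1 hi1).1
    · exact (ae_restrict_iff' measurableSet_ball).2 (Eventually.of_forall fun y hy =>
        (div_nonneg (norm_nonneg _) hC0.le).trans (hg y (hρ (ball_subset_closedBall hy)) _).1)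
  · have hle : ((hyperplaneMeasure b x).restrict Ω).restrict (closedBall x r)ᶜ (ball x ρ) ≤
        hyperplaneMeasure b x (ball x ρ \ closedBall x r) := by
      rw [Measure.restrict_apply measurableSet_ball]
      exact Measure.restrict_apply_le _ _
    have hlt : hyperplaneMeasure b x (ball x ρ \ closedBall x r) < ⊤ :=
      (measure_mono (Set.sdiff_subset.trans ball_subset_closedBall)).trans_lt
        (hyperplaneMeasure_closedBall_lt_top b x ρ)
    refine (setIntegral_le_of_ae_norm_eq_one hC hg hρ ?_ (hle.trans_lt hlt)).trans
      (mul_le_mul_of_nonneg_left (ENNReal.toReal_mono hlt.ne hle) hC0.le)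
    rw [ae_restrict_iff' isClosed_closedBall.measurableSet.compl]
    refine Eventually.of_forall fun y hy => ?_
    rw [glueNormal_of_notMem_closedBall hy]
    exact b.orthonormal.1 0
  · refine (setIntegral_le_of_ae_norm_eq_one hC hg hρ
      (ae_jumpSphereMeasure hr fun ω hω => norm_glueNormal_of_mem_jumpDirections hr hω)
      (measure_lt_top _ _)).trans (mul_le_mul_of_nonneg_left ?_ hC0.le)
    have := ENNReal.toReal_mono (measure_ne_top _ _)
      (measure_mono (μ := jumpSphereMeasure x ν (b 0) r) (Set.subset_univ (ball x ρ)))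
    rwa [jumpSphereMeasure_univ _ _ _ hr, ENNReal.toReal_mul,
      ENNReal.toReal_ofReal (by positivity)] at this

theorem bddBelow_mloc (hC : 1 < C) (hg : ∀ x ∈ Ω, ∀ ν, ‖ν‖ / C ≤ g x ν ∧ g x ν ≤ C * ‖ν‖)
    (hρ : closedBall x ρ ⊆ Ω) (ν : EuclideanSpace ℝ (Fin (n + 1))) :
    ∀ e ∈ {e : ℝ | ∃ (v : EuclideanSpace ℝ (Fin (n + 1)) → ℝ)
      (σ : Measure (EuclideanSpace ℝ (Fin (n + 1))))
      (f : EuclideanSpace ℝ (Fin (n + 1)) → EuclideanSpace ℝ (Fin (n + 1))),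
    IsSpinRep Ω v σ f ∧
    (∃ δ : ℝ, 0 < δ ∧ ∀ᵐ y ∂volume, y ∈ Ω → |dist y x - ρ| < δ → v y = ujump x ν y) ∧
    e = surfE g σ f (ball x ρ)}, 0 ≤ e := by
  rintro e ⟨v, σ, f, -, -, rfl⟩
  exact surfE_nonneg hC hg hρ σ f

theorem mloc_le_add (hΩ : IsOpen Ω) (hC : 1 < C)
    (hg : ∀ x ∈ Ω, ∀ ν, ‖ν‖ / C ≤ g x ν ∧ g x ν ≤ C * ‖ν‖)
    (hρ0 : 0 < ρ) (hρ : closedBall x ρ ⊆ Ω) (hν₁ : ‖ν‖ = 1)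
    {ν₂ : EuclideanSpace ℝ (Fin (n + 1))} (hν₂ : ‖ν₂‖ = 1) :
    mloc Ω g x ν₂ ρ ≤ mloc Ω g x ν ρ + C * (ρ ^ n *
      ((volume : Measure (EuclideanSpace ℝ (Fin (n + 1)))).toSphere
        (jumpDirections ν ν₂)).toReal) := by
  have hC0 : 0 < C := by linarith
  obtain ⟨b, rfl⟩ := exists_orthonormalBasis_apply_zero hν₂
  rw [← sub_le_iff_le_add]
  refine le_csInf ?_ ?_
  · obtain ⟨b', rfl⟩ := exists_orthonormalBasis_apply_zero hν₁
    exact ⟨_, _, _, _, isSpinRep_ujump b' hΩ x, ⟨1, one_pos, Eventually.of_forall fun _ _ _ => rfl⟩,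
      rfl⟩
  rintro e ⟨v, σ, f, h, ⟨δ, hδ, hv⟩, rfl⟩
  rw [sub_le_iff_le_add]
  refine le_of_forall_pos_le_add fun ε hε => ?_
  obtain ⟨s₁, hs₁, hm⟩ := exists_ball_of_aestronglyMeasurable_imp (x := x) (ρ := ρ) σ
    fun y => g y (f y)
  obtain ⟨s₂, hs₂, hsh⟩ := exists_measure_shell_le (x := x) (ρ := ρ) (hyperplaneMeasure b x)
    (measure_ne_top_of_subset ball_subset_closedBall
      (hyperplaneMeasure_closedBall_lt_top b x ρ).ne) (ε := ENNReal.ofReal (ε / C)) (by positivity)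
  obtain ⟨r, hr, hrρ, hσ⟩ := exists_sphere_measure_eq_zero (s := max (max s₁ s₂) (max 0 (ρ - δ)))
    (h.measure_lt_top_of_isCompact (isCompact_closedBall x ρ) hρ) (by simp [*])
  simp only [max_lt_iff] at hr
  obtain ⟨⟨hr₁, hr₂⟩, hr0, hrδ⟩ := hr
  have hv' : ∀ᵐ y ∂volume, y ∈ closedBall x ρ → r ≤ dist y x → v y = ujump x ν y := by
    filter_upwards [hv] with y hy h1 h2
    refine hy (hρ h1) (abs_lt.2 ⟨by linarith, ?_⟩)
    linarith [mem_closedBall.1 h1]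
  refine (csInf_le ⟨0, bddBelow_mloc hC hg hρ (b 0)⟩ ⟨_, _, _,
    isSpinRep_glue b hΩ h hν₁ hr0 hrρ hρ hv' hσ, ⟨ρ - r, by linarith, ?_⟩, rfl⟩).trans
    ((surfE_glue_le b hC hg h hr0 hrρ hρ (hm r hr₁.le)).trans ?_)
  · refine Eventually.of_forall fun y _ hy => glue_of_lt_dist ?_
    linarith [(abs_lt.1 hy).1]
  · have h1 : C * (hyperplaneMeasure b x (ball x ρ \ closedBall x r)).toReal ≤ ε := by
      have := ENNReal.toReal_mono ENNReal.ofReal_ne_top (hsh r hr₂.le)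
      rw [ENNReal.toReal_ofReal (by positivity), le_div_iff₀ hC0] at this
      linarith
    have h2 : C * (r ^ n * ((volume : Measure (EuclideanSpace ℝ (Fin (n + 1)))).toSphere
        (jumpDirections ν (b 0))).toReal) ≤ C * (ρ ^ n *
        ((volume : Measure (EuclideanSpace ℝ (Fin (n + 1)))).toSphere
        (jumpDirections ν (b 0))).toReal) := by gcongr
    linarith

end Competitor

section SphereMeasure

open scoped Pointwise

variable {n : ℕ}

theorem smul_sphere_subset_adaptedMap
    {b : OrthonormalBasis (Fin (n + 1)) ℝ (EuclideanSpace ℝ (Fin (n + 1)))} {δ : ℝ}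
    {s : Set (sphere (0 : EuclideanSpace ℝ (Fin (n + 1))) 1)}
    (hs : ∀ ω ∈ s, dist ω.1 (b 0) ≤ δ) :
    Set.Ioo (0 : ℝ) 1 • ((↑) '' s : Set (EuclideanSpace ℝ (Fin (n + 1)))) ⊆
      adaptedMap b '' (Set.Icc (-1) 1 ×ˢ Set.Icc (fun _ => -δ) (fun _ => δ)) := by
  rintro _ ⟨t, ht, _, ⟨ω, hω, rfl⟩, rfl⟩
  refine ⟨_, ⟨?_, ?_⟩, adaptedMap_inner b _⟩
  · refine abs_le.1 ((abs_real_inner_le_norm _ _).trans ?_)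
    rw [b.norm_eq_one, one_mul, norm_smul, norm_eq_of_mem_sphere ω, mul_one, Real.norm_of_nonneg
      ht.1.le]
    exact ht.2.le
  · have h (i : Fin n) : |⟪b i.succ, t • ω.1⟫| ≤ δ := by
      have hi : ⟪b i.succ, ω.1⟫ = ⟪b i.succ, ω.1 - b 0⟫ := by
        rw [inner_sub_right, b.inner_eq_zero (Fin.succ_ne_zero i), sub_zero]
      rw [inner_smul_right, abs_mul, abs_of_pos ht.1, hi]
      have := abs_real_inner_le_norm (b i.succ) (ω.1 - b 0)
      rw [b.norm_eq_one, one_mul, ← dist_eq_norm] at this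
      exact (mul_le_of_le_one_left (abs_nonneg _) ht.2.le).trans (this.trans (hs ω hω))
    exact ⟨fun i => (abs_le.1 (h i)).1, fun i => (abs_le.1 (h i)).2⟩

theorem toSphere_le_ediam_pow (s : Set (sphere (0 : EuclideanSpace ℝ (Fin (n + 1))) 1)) :
    (volume : Measure (EuclideanSpace ℝ (Fin (n + 1)))).toSphere s ≤
      ((n + 1) * 2 * 2 ^ n) * ediam s ^ n := by
  obtain rfl | ⟨ω, hω⟩ := s.eq_empty_or_nonempty
  · simp
  obtain ⟨b, hb⟩ := exists_orthonormalBasis_apply_zero (norm_eq_of_mem_sphere ω)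
  have hd : ediam s ≠ ⊤ := isBounded_iff_ediam_ne_top.1 (isBounded_of_compactSpace)
  refine (measure_mono subset_closure).trans ?_
  rw [Measure.toSphere_apply' _ isClosed_closure.measurableSet, mul_assoc, mul_assoc]
  have hδ : ∀ η ∈ closure s, dist η.1 (b 0) ≤ diam s := by
    intro η hη
    rw [hb, ← diam_closure]
    exact dist_le_diam_of_mem isBounded_of_compactSpace hη (subset_closure hω)
  refine mul_le_mul' (by simp) ((measure_mono (smul_sphere_subset_adaptedMap hδ)).trans ?_)
  rw [← (measurePreserving_adaptedMap b).map_eq, (measurableEmbedding_adaptedMap b).map_apply,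
    Set.preimage_image_eq _ (measurableEmbedding_adaptedMap b).injective, Measure.volume_eq_prod,
    Measure.prod_prod, Real.volume_Icc, Real.volume_Icc_pi]
  simp only [sub_neg_eq_add, Finset.prod_const, Finset.card_univ, Fintype.card_fin]
  rw [← two_mul (diam s), ENNReal.ofReal_mul zero_le_two, diam, ENNReal.ofReal_toReal hd, mul_pow]
  norm_num

theorem toSphere_le_hausdorffMeasure (s : Set (sphere (0 : EuclideanSpace ℝ (Fin (n + 1))) 1)) :
    (volume : Measure (EuclideanSpace ℝ (Fin (n + 1)))).toSphere s ≤
      ((n + 1) * 2 * 2 ^ n) * μH[n] ((↑) '' s : Set (EuclideanSpace ℝ (Fin (n + 1)))) := by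
  set K : ENNReal := (n + 1) * 2 * 2 ^ n with hK
  have hK0 : K ≠ 0 := by simp [hK]
  have hKt : K ≠ ⊤ := by
    rw [hK]; finiteness
  have h := Measure.le_hausdorffMeasure n
    (K⁻¹ • (volume : Measure (EuclideanSpace ℝ (Fin (n + 1)))).toSphere) 1 one_pos fun s _ => by
      rw [Measure.smul_apply, smul_eq_mul, ENNReal.inv_mul_le_iff hK0 hKt, ENNReal.rpow_natCast]
      exact toSphere_le_ediam_pow s
  rw [isometry_subtype_coe.hausdorffMeasure_image (Or.inl n.cast_nonneg),
    ← ENNReal.inv_mul_le_iff hK0 hKt]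
  exact h s

end SphereMeasure

section Band

variable {n : ℕ}

theorem hausdorffMeasure_le_of_dist_le {X Y : Type*} [MetricSpace X] [MeasurableSpace X]
    [BorelSpace X] [MetricSpace Y] [MeasurableSpace Y] [BorelSpace Y] {f : X → Y} {K : NNReal}
    {s : Set X} {r : ℝ} (hr : 0 ≤ r) (h : ∀ x ∈ s, ∀ y ∈ s, dist x y ≤ K * dist (f x) (f y)) :
    μH[r] s ≤ (K : ENNReal) ^ r * μH[r] (f '' s) := by
  have hf : AntilipschitzWith K fun x : s => f x :=
    AntilipschitzWith.of_le_mul_dist fun x y => h x x.2 y y.2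
  have := hf.le_hausdorffMeasure_image hr Set.univ
  rwa [← isometry_subtype_coe.hausdorffMeasure_image (Or.inl hr), Set.image_univ,
    Subtype.range_coe, Set.image_univ, ← Function.comp_def f, Set.range_comp,
    Subtype.range_coe] at this

variable (b : OrthonormalBasis (Fin (n + 1)) ℝ (EuclideanSpace ℝ (Fin (n + 1))))

/-- The part of the band `|⟪b 0, y⟫| ≤ θ` of the unit sphere on which the coordinate `ε * ⟪b i, y⟫`
is bounded below. -/
def bandCap (θ ε : ℝ) (i : Fin (n + 1)) : Set (EuclideanSpace ℝ (Fin (n + 1))) :=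
  {y | ‖y‖ = 1 ∧ |⟪b 0, y⟫| ≤ θ ∧ ((n : ℝ) + 1)⁻¹ ≤ ε * ⟪b i, y⟫}

theorem dist_le_of_mem_bandCap {θ ε : ℝ} (hε : ε = 1 ∨ ε = -1) {i : Fin (n + 1)}
    {y y' : EuclideanSpace ℝ (Fin (n + 1))} (hy : y ∈ bandCap b θ ε i)
    (hy' : y' ∈ bandCap b θ ε i) :
    dist y y' ≤ ((n : ℝ) + 1) ^ 2 *
      dist (fun j => ⟪b (i.succAbove j), y⟫) (fun j => ⟪b (i.succAbove j), y'⟫) := by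
  set D := dist (fun j => ⟪b (i.succAbove j), y⟫) (fun j => ⟪b (i.succAbove j), y'⟫)
  have hD : 0 ≤ D := dist_nonneg
  have hj (j : Fin n) : |⟪b (i.succAbove j), y⟫ - ⟪b (i.succAbove j), y'⟫| ≤ D := by
    rw [← Real.dist_eq]
    exact dist_le_pi_dist (fun j => ⟪b (i.succAbove j), y⟫) (fun j => ⟪b (i.succAbove j), y'⟫) j
  have hle {z : EuclideanSpace ℝ (Fin (n + 1))} (hz : ‖z‖ = 1) (k : Fin (n + 1)) :
      |⟪b k, z⟫| ≤ 1 := by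
    simpa [hz] using abs_real_inner_le_norm (b k) z
  have hsum : |⟪b i, y⟫ ^ 2 - ⟪b i, y'⟫ ^ 2| ≤ n * (2 * D) := by
    have h := b.sum_sq_inner_right y
    have h' := b.sum_sq_inner_right y'
    rw [hy.1, Fin.sum_univ_succAbove _ i] at h
    rw [hy'.1, Fin.sum_univ_succAbove _ i] at h'
    have : ⟪b i, y⟫ ^ 2 - ⟪b i, y'⟫ ^ 2 =
        ∑ j, (⟪b (i.succAbove j), y'⟫ ^ 2 - ⟪b (i.succAbove j), y⟫ ^ 2) := by
      rw [Finset.sum_sub_distrib]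
      linarith
    rw [this]
    refine (Finset.abs_sum_le_sum_abs _ _).trans ?_
    refine (Finset.sum_le_card_nsmul _ _ (2 * D) fun j _ => ?_).trans (by simp)
    rw [sq_sub_sq, abs_mul, abs_sub_comm]
    refine mul_le_mul ((abs_add_le _ _).trans ?_) (hj j) (abs_nonneg _) zero_le_two
    linarith [hle hy.1 (i.succAbove j), hle hy'.1 (i.succAbove j)]
  have hi : |⟪b i, y⟫ - ⟪b i, y'⟫| ≤ n * (n + 1) * D := by
    have hlow : 2 * ((n : ℝ) + 1)⁻¹ ≤ |⟪b i, y⟫ + ⟪b i, y'⟫| := by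
      have h₁ := hy.2.2
      have h₂ := hy'.2.2
      obtain rfl | rfl := hε
      · exact le_trans (by linarith) (le_abs_self _)
      · exact le_trans (by linarith) (neg_le_abs _)
    rw [sq_sub_sq, abs_mul] at hsum
    have h := (mul_le_mul_of_nonneg_right hlow (abs_nonneg (⟪b i, y⟫ - ⟪b i, y'⟫))).trans hsum
    have hn : (0 : ℝ) < n + 1 := by positivity
    rw [mul_comm (2 : ℝ), mul_assoc, inv_mul_le_iff₀ hn] at h
    linarith
  have hsq : dist y y' ^ 2 ≤ (((n : ℝ) + 1) ^ 2 * D) ^ 2 := by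
    rw [dist_eq_norm, ← b.sum_sq_inner_right (y - y'), Fin.sum_univ_succAbove _ i]
    simp only [inner_sub_right]
    have h₁ := pow_le_pow_left₀ (abs_nonneg _) hi 2
    have h₂ : ∑ j, (⟪b (i.succAbove j), y⟫ - ⟪b (i.succAbove j), y'⟫) ^ 2 ≤ n * D ^ 2 := by
      refine (Finset.sum_le_card_nsmul _ _ (D ^ 2) fun j _ => ?_).trans (by simp)
      rw [← sq_abs]
      exact pow_le_pow_left₀ (abs_nonneg _) (hj j) 2
    rw [sq_abs] at h₁
    refine (add_le_add h₁ h₂).trans ?_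
    have : (((n : ℝ) + 1) ^ 2 * D) ^ 2 - ((n * (n + 1) * D) ^ 2 + n * D ^ 2) =
      (2 * n ^ 3 + 5 * n ^ 2 + 3 * n + 1) * D ^ 2 := by ring
    have : 0 ≤ (2 * (n : ℝ) ^ 3 + 5 * n ^ 2 + 3 * n + 1) * D ^ 2 := by positivity
    linarith
  exact (sq_le_sq₀ dist_nonneg (by positivity)).1 hsq

theorem hausdorffMeasure_bandCap_le {θ ε : ℝ} (hθ : 0 ≤ θ) (hε : ε = 1 ∨ ε = -1)
    (i : Fin (n + 1)) :
    μH[n] (bandCap b θ ε i) ≤ (ENNReal.ofReal (((n : ℝ) + 1) ^ 2)) ^ n *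
      ENNReal.ofReal (2 ^ n * ((n + 1) * θ)) := by
  set f : EuclideanSpace ℝ (Fin (n + 1)) → Fin n → ℝ := fun y j => ⟪b (i.succAbove j), y⟫
  have h := hausdorffMeasure_le_of_dist_le (s := bandCap b θ ε i) (f := f) (r := n)
    (K := (((n : ℝ) + 1) ^ 2).toNNReal) n.cast_nonneg fun y hy y' hy' => by
      rw [Real.coe_toNNReal _ (by positivity)]
      exact dist_le_of_mem_bandCap b hε hy hy'
  rw [ENNReal.rpow_natCast] at h
  refine h.trans (mul_le_mul' le_rfl ?_)
  have hvol : (μH[n] : Measure (Fin n → ℝ)) = volume := by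
    simpa using hausdorffMeasure_pi_real (ι := Fin n)
  rw [hvol]
  obtain h0 | ⟨y₀, hy₀⟩ := (bandCap b θ ε i).eq_empty_or_nonempty
  · simp [h0]
  set r : Fin n → ℝ := fun j => if i.succAbove j = 0 then θ else 1 with hr
  have hr0 (j : Fin n) : 0 ≤ r j := by
    simp only [hr]; split_ifs <;> simp [hθ]
  have hsub : f '' bandCap b θ ε i ⊆ Set.Icc (-r) r := by
    rintro _ ⟨y, hy, rfl⟩
    have hj (j : Fin n) : |f y j| ≤ r j := by
      simp only [f, hr]
      split_ifs with hj
      · rw [hj]; exact hy.2.1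
      · simpa [hy.1] using abs_real_inner_le_norm (b (i.succAbove j)) y
    exact ⟨fun j => (abs_le.1 (hj j)).1, fun j => (abs_le.1 (hj j)).2⟩
  refine (measure_mono hsub).trans ?_
  rw [Real.volume_Icc_pi, ← ENNReal.ofReal_prod_of_nonneg fun j _ => by simpa using hr0 j]
  refine ENNReal.ofReal_le_ofReal ?_
  simp only [Pi.neg_apply, sub_neg_eq_add, ← two_mul, Finset.prod_mul_distrib, Finset.prod_const,
    Finset.card_univ, Fintype.card_fin]
  refine mul_le_mul_of_nonneg_left ?_ (by positivity)
  have hn : (0 : ℝ) < n + 1 := by positivity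
  obtain rfl | hi := eq_or_ne i 0
  · have : ∏ j, r j = 1 := Finset.prod_eq_one fun j _ => by
      simp only [hr]; rw [if_neg (by simp [Fin.succ_ne_zero])]
    rw [this, ← inv_le_iff_one_le_mul₀' hn]
    refine hy₀.2.2.trans (le_trans ?_ hy₀.2.1)
    obtain rfl | rfl := hε
    · simpa using le_abs_self ⟪b 0, y₀⟫
    · simpa using neg_le_abs ⟪b 0, y₀⟫
  · obtain ⟨j₀, hj₀⟩ := Fin.exists_succAbove_eq hi.symm
    rw [Finset.prod_eq_single j₀]
    · simp only [hr]
      rw [if_pos hj₀]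
      nlinarith [n.cast_nonneg (α := ℝ)]
    · intro j _ hj
      simp only [hr]
      rw [if_neg]
      rw [← hj₀]
      exact fun h => hj (Fin.succAbove_right_injective h)
    · simp

theorem hausdorffMeasure_band_le {θ : ℝ} (hθ : 0 ≤ θ) :
    μH[n] {y : EuclideanSpace ℝ (Fin (n + 1)) | ‖y‖ = 1 ∧ |⟪b 0, y⟫| ≤ θ} ≤
      ENNReal.ofReal (2 * (n + 1) * ((((n : ℝ) + 1) ^ 2) ^ n * (2 ^ n * (n + 1))) * θ) := by
  have hsub : {y : EuclideanSpace ℝ (Fin (n + 1)) | ‖y‖ = 1 ∧ |⟪b 0, y⟫| ≤ θ} ⊆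
      ⋃ i, (bandCap b θ 1 i ∪ bandCap b θ (-1) i) := by
    rintro y ⟨hy, hyθ⟩
    have hn : (0 : ℝ) < n + 1 := by positivity
    obtain ⟨i, hi⟩ : ∃ i, ((n : ℝ) + 1)⁻¹ ≤ |⟪b i, y⟫| := by
      by_contra! hlt
      have h := b.sum_sq_inner_right y
      have h' : ∑ i, ⟪b i, y⟫ ^ 2 < ∑ i : Fin (n + 1), ((n : ℝ) + 1)⁻¹ ^ 2 :=
        Finset.sum_lt_sum_of_nonempty Finset.univ_nonempty fun i _ => by
          rw [← sq_abs]
          exact pow_lt_pow_left₀ (hlt i) (abs_nonneg _) two_ne_zero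
      rw [h, hy] at h'
      have h1 : ((n : ℝ) + 1)⁻¹ ≤ 1 := inv_le_one_of_one_le₀ (by simp)
      simp only [Finset.sum_const, Finset.card_univ, Fintype.card_fin, nsmul_eq_mul, Nat.cast_add,
        Nat.cast_one, sq, mul_inv_cancel_left₀ hn.ne'] at h'
      linarith
    refine Set.mem_iUnion.2 ⟨i, ?_⟩
    obtain h | h := le_abs.1 hi
    · exact Or.inl ⟨hy, hyθ, by rwa [one_mul]⟩
    · exact Or.inr ⟨hy, hyθ, by rwa [neg_one_mul]⟩
  refine (measure_mono hsub).trans ((measure_iUnion_fintype_le _ _).trans ?_)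
  refine (Finset.sum_le_card_nsmul _ _ _ fun i _ => (measure_union_le _ _).trans
    (add_le_add (hausdorffMeasure_bandCap_le b hθ (Or.inl rfl) i)
      (hausdorffMeasure_bandCap_le b hθ (Or.inr rfl) i))).trans (le_of_eq ?_)
  rw [← ENNReal.ofReal_pow (by positivity), ← ENNReal.ofReal_mul (by positivity),
    ← ENNReal.ofReal_add (by positivity) (by positivity), Finset.card_univ, Fintype.card_fin,
    ← ENNReal.ofReal_nsmul]
  congr 1
  simp only [nsmul_eq_mul, Nat.cast_add, Nat.cast_one]
  ring

end Band

section Assembly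

variable {n : ℕ} {x ν₁ ν₂ : EuclideanSpace ℝ (Fin (n + 1))} {ρ : ℝ}

theorem norm_sub_le_arccos_inner {E : Type*} [NormedAddCommGroup E] [InnerProductSpace ℝ E]
    {v w : E} (hv : ‖v‖ = 1) (hw : ‖w‖ = 1) : ‖v - w‖ ≤ Real.arccos ⟪v, w⟫ := by
  have hi : |⟪v, w⟫| ≤ 1 := by simpa [hv, hw] using abs_real_inner_le_norm v w
  have h := Real.one_sub_sq_div_two_le_cos (x := Real.arccos ⟪v, w⟫)
  rw [Real.cos_arccos (abs_le.1 hi).1 (abs_le.1 hi).2] at h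
  refine (sq_le_sq₀ (norm_nonneg _) (Real.arccos_nonneg _)).1 ?_
  rw [norm_sub_sq_real, hv, hw]
  linarith

theorem jumpDirections_comm (ν₁ ν₂ : EuclideanSpace ℝ (Fin d)) :
    jumpDirections ν₁ ν₂ = jumpDirections ν₂ ν₁ :=
  Set.ext fun _ => ne_comm

theorem hausdorffMeasure_jumpDirections_le (hν₁ : ‖ν₁‖ = 1) :
    μH[n] ((↑) '' jumpDirections ν₁ ν₂ : Set (EuclideanSpace ℝ (Fin (n + 1)))) ≤
      ENNReal.ofReal (2 * (n + 1) * ((((n : ℝ) + 1) ^ 2) ^ n * (2 ^ n * (n + 1))) *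
        ‖ν₁ - ν₂‖) := by
  obtain ⟨b, rfl⟩ := exists_orthonormalBasis_apply_zero hν₁
  refine (measure_mono ?_).trans (hausdorffMeasure_band_le b (norm_nonneg _))
  rintro _ ⟨ω, hω, rfl⟩
  have hω1 : ‖ω.1‖ = 1 := norm_eq_of_mem_sphere ω
  refine ⟨hω1, ?_⟩
  have hd : |⟪b 0, ω.1⟫ - ⟪ν₂, ω.1⟫| ≤ ‖b 0 - ν₂‖ := by
    rw [← inner_sub_left]
    simpa [hω1] using abs_real_inner_le_norm (b 0 - ν₂) ω.1
  have hω' : ujump 0 (b 0) ω.1 ≠ ujump 0 ν₂ ω.1 := hω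
  simp only [ujump, sub_zero] at hω'
  rw [real_inner_comm ω.1, real_inner_comm ω.1] at hd
  rw [real_inner_comm ω.1, abs_le]
  rw [abs_le] at hd
  split_ifs at hω' with h₁ h₂ h₂
  · exact absurd rfl hω'
  · constructor <;> linarith [hd.1, hd.2]
  · constructor <;> linarith [hd.1, hd.2]
  · exact absurd rfl hω'

theorem setOf_ujump_ne_inter_sphere (hρ : 0 < ρ) :
    {y | ujump x ν₁ y ≠ ujump x ν₂ y} ∩ sphere x ρ =
      (fun y => x + y) '' ((fun y => ρ • y) '' ((↑) '' jumpDirections ν₁ ν₂)) := by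
  ext y
  simp only [Set.image_image, Set.mem_image]
  constructor
  · rintro ⟨hy, hyρ⟩
    have hn : ‖y - x‖ = ρ := by rwa [mem_sphere_iff_norm] at hyρ
    refine ⟨⟨ρ⁻¹ • (y - x), ?_⟩, ?_, ?_⟩
    · rw [mem_sphere_zero_iff_norm, norm_smul, hn, Real.norm_of_nonneg (by positivity),
        inv_mul_cancel₀ hρ.ne']
    · change ujump 0 ν₁ (ρ⁻¹ • (y - x)) ≠ ujump 0 ν₂ (ρ⁻¹ • (y - x))
      rw [ujump_zero_smul _ _ (inv_pos.2 hρ), ujump_zero_smul _ _ (inv_pos.2 hρ),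
        ← ujump_eq_ujump_zero, ← ujump_eq_ujump_zero]
      exact hy
    · rw [smul_inv_smul₀ hρ.ne', add_sub_cancel]
  · rintro ⟨ω, hω, rfl⟩
    refine ⟨?_, ?_⟩
    · rw [Set.mem_ofPred_eq, ujump_eq_ujump_zero x ν₁, ujump_eq_ujump_zero x ν₂,
        add_sub_cancel_left, ujump_zero_smul _ _ hρ, ujump_zero_smul _ _ hρ]
      exact hω
    · rw [mem_sphere_iff_norm, add_sub_cancel_left, norm_smul, norm_eq_of_mem_sphere ω, mul_one,
        Real.norm_of_nonneg hρ.le]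

open scoped Pointwise in
theorem hausdorffMeasure_setOf_ujump_ne (hρ : 0 < ρ) :
    μH[n] ({y | ujump x ν₁ y ≠ ujump x ν₂ y} ∩ sphere x ρ) =
      ENNReal.ofReal (ρ ^ n) *
        μH[n] ((↑) '' jumpDirections ν₁ ν₂ : Set (EuclideanSpace ℝ (Fin (n + 1)))) := by
  rw [setOf_ujump_ne_inter_sphere hρ,
    Isometry.hausdorffMeasure_image (isometry_add_left x) (Or.inl n.cast_nonneg),
    Set.image_smul, Measure.hausdorffMeasure_smul₀ n.cast_nonneg hρ.ne', NNReal.rpow_natCast,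
    ENNReal.smul_def, smul_eq_mul, ENNReal.ofReal_pow hρ.le, ENNReal.coe_pow]
  congr 2
  rw [← enorm_eq_nnnorm, Real.enorm_of_nonneg hρ.le]

theorem setIntegral_abs_ujump_sub (hρ : 0 < ρ) :
    ∫ y in sphere x ρ, |ujump x ν₁ y - ujump x ν₂ y| ∂(μH[n]) =
      2 * (ρ ^ n * (μH[n] ((↑) '' jumpDirections ν₁ ν₂ :
        Set (EuclideanSpace ℝ (Fin (n + 1))))).toReal) := by
  have hms : MeasurableSet {y | ujump x ν₁ y ≠ ujump x ν₂ y} :=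
    (measurableSet_eq_fun (measurable_ujump x ν₁) (measurable_ujump x ν₂)).compl
  have hind : (fun y => |ujump x ν₁ y - ujump x ν₂ y|) =
      {y | ujump x ν₁ y ≠ ujump x ν₂ y}.indicator fun _ => 2 := by
    ext y
    by_cases h : ujump x ν₁ y = ujump x ν₂ y
    · rw [Set.indicator_of_notMem (by simpa using h), h, sub_self, abs_zero]
    · rw [Set.indicator_of_mem h]
      obtain h₁ | h₁ := ujump_eq_or x ν₁ y <;> obtain h₂ | h₂ := ujump_eq_or x ν₂ y <;>
        rw [h₁, h₂] at h ⊢ <;> first | exact absurd rfl h | norm_num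
  rw [hind, integral_indicator hms, setIntegral_const, measureReal_def, Measure.restrict_apply hms,
    hausdorffMeasure_setOf_ujump_ne hρ, ENNReal.toReal_mul, ENNReal.toReal_ofReal (by positivity),
    smul_eq_mul, mul_comm]

theorem abs_mloc_sub_le {Ω : Set (EuclideanSpace ℝ (Fin (n + 1)))} {C : ℝ}
    {g : EuclideanSpace ℝ (Fin (n + 1)) → EuclideanSpace ℝ (Fin (n + 1)) → ℝ} (hΩ : IsOpen Ω)
    (hC : 1 < C) (hg : ∀ x ∈ Ω, ∀ ν, ‖ν‖ / C ≤ g x ν ∧ g x ν ≤ C * ‖ν‖) (hρ0 : 0 < ρ)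
    (hρ : closedBall x ρ ⊆ Ω) (hν₁ : ‖ν₁‖ = 1) (hν₂ : ‖ν₂‖ = 1) :
    |mloc Ω g x ν₁ ρ - mloc Ω g x ν₂ ρ| ≤ C * ((n + 1) * 2 ^ n) *
      ∫ y in sphere x ρ, |ujump x ν₁ y - ujump x ν₂ y| ∂(μH[n]) := by
  have hS : ((volume : Measure (EuclideanSpace ℝ (Fin (n + 1)))).toSphere
      (jumpDirections ν₁ ν₂)).toReal ≤ ((n + 1) * 2 * 2 ^ n) *
        (μH[n] ((↑) '' jumpDirections ν₁ ν₂ : Set (EuclideanSpace ℝ (Fin (n + 1))))).toReal := by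
    have hfin := ((hausdorffMeasure_jumpDirections_le (ν₂ := ν₂) hν₁).trans_lt
      ENNReal.ofReal_lt_top).ne
    have h := ENNReal.toReal_mono (by finiteness) (toSphere_le_hausdorffMeasure _)
    rw [ENNReal.toReal_mul] at h
    convert h using 2
    norm_cast
  rw [setIntegral_abs_ujump_sub hρ0]
  have hC0 : 0 < C := by linarith
  have h₁ := mloc_le_add hΩ hC hg hρ0 hρ hν₁ hν₂
  have h₂ := mloc_le_add hΩ hC hg hρ0 hρ hν₂ hν₁
  rw [jumpDirections_comm] at h₂
  have h := mul_le_mul_of_nonneg_left hS (show 0 ≤ C * ρ ^ n by positivity)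
  rw [abs_le]
  constructor <;> linarith

end Assembly

/-- Continuity of the localized minimum problem in the normal direction:
`|m(x,ν₁,ρ) - m(x,ν₂,ρ)| ≤ C₁ ∫_{∂B_ρ(x)} |tr(u_{x,ν₁} - u_{x,ν₂})| dH^{d-1}
≤ C₂ ρ^{d-1} arccos⟨ν₁,ν₂⟩`, with constants depending only on `d` and the growth
constant `C`; in particular `ν ↦ m(x,ν,ρ)` admits a modulus of continuity of the form
`ρ^{d-1} ω(|ν₁-ν₂|)`. -/
theorem mloc_normal_stability (C : ℝ) (hC : 1 < C) :
    ∃ C₁ C₂ : ℝ, 0 < C₁ ∧ 0 < C₂ ∧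
    ∃ w : ℝ → ℝ, Monotone w ∧ w 0 = 0 ∧ ContinuousAt w 0 ∧
    ∀ (Ω : Set (EuclideanSpace ℝ (Fin d))), IsOpen Ω → Bornology.IsBounded Ω →
    ∀ g : EuclideanSpace ℝ (Fin d) → EuclideanSpace ℝ (Fin d) → ℝ,
      (∀ x ∈ Ω, ∀ ν, ‖ν‖ / C ≤ g x ν ∧ g x ν ≤ C * ‖ν‖) →
    ∀ x : EuclideanSpace ℝ (Fin d), x ∈ Ω →
    ∀ ρ : ℝ, 0 < ρ → ρ < infDist x Ωᶜ →
    ∀ ν₁ ν₂ : EuclideanSpace ℝ (Fin d), ‖ν₁‖ = 1 → ‖ν₂‖ = 1 →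
      |mloc Ω g x ν₁ ρ - mloc Ω g x ν₂ ρ| ≤
        C₁ * ∫ y in sphere x ρ, |ujump x ν₁ y - ujump x ν₂ y| ∂(μH[(d:ℝ) - 1]) ∧
      C₁ * (∫ y in sphere x ρ, |ujump x ν₁ y - ujump x ν₂ y| ∂(μH[(d:ℝ) - 1])) ≤
        C₂ * ρ ^ (d - 1) * Real.arccos ⟪ν₁, ν₂⟫ ∧
      |mloc Ω g x ν₁ ρ - mloc Ω g x ν₂ ρ| ≤ ρ ^ (d - 1) * w ‖ν₁ - ν₂‖ := by
  obtain _ | n := d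
  · refine ⟨1, 1, one_pos, one_pos, 0, monotone_const, rfl, continuousAt_const, ?_⟩
    intro Ω _ _ g _ x _ ρ _ _ ν₁ _ hν₁
    simp [Subsingleton.elim ν₁ 0] at hν₁
  have hC0 : 0 < C := by linarith
  set C₁ : ℝ := C * ((n + 1) * 2 ^ n)
  set K : ℝ := 2 * (n + 1) * ((((n : ℝ) + 1) ^ 2) ^ n * (2 ^ n * (n + 1)))
  have hC₁ : 0 < C₁ := by positivity
  have hK : 0 < K := by positivity
  refine ⟨C₁, 2 * C₁ * K, hC₁, by positivity, fun s => 2 * C₁ * K * s,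
    fun s t h => mul_le_mul_of_nonneg_left h (by positivity), mul_zero _, by fun_prop, ?_⟩
  intro Ω hΩ _ g hg x hx ρ hρ0 hρ ν₁ ν₂ hν₁ hν₂
  have hball : closedBall x ρ ⊆ Ω := fun y hy => by
    by_contra hyΩ
    have := infDist_le_dist_of_mem (x := x) (show y ∈ Ωᶜ from hyΩ)
    rw [dist_comm] at this
    linarith [mem_closedBall.1 hy]
  have hd : ((n + 1 : ℕ) : ℝ) - 1 = n := by push_cast; ring
  have habs := abs_mloc_sub_le hΩ hC hg hρ0 hball hν₁ hν₂
  have hint : C₁ * (∫ y in sphere x ρ, |ujump x ν₁ y - ujump x ν₂ y| ∂(μH[n])) ≤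
      ρ ^ n * (2 * C₁ * K * ‖ν₁ - ν₂‖) := by
    have h := ENNReal.toReal_le_of_le_ofReal (by positivity)
      (hausdorffMeasure_jumpDirections_le (ν₂ := ν₂) hν₁)
    rw [setIntegral_abs_ujump_sub hρ0]
    have := mul_le_mul_of_nonneg_left h (show 0 ≤ C₁ * 2 * ρ ^ n by positivity)
    linarith
  rw [hd, Nat.add_sub_cancel]
  refine ⟨habs, hint.trans ?_, habs.trans hint⟩
  have := mul_le_mul_of_nonneg_left (norm_sub_le_arccos_inner hν₁ hν₂)
    (show 0 ≤ 2 * C₁ * K * ρ ^ n by positivity)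
  linarith
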